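/- Let n ≥ 2, r,s ∈ {0,1}, and M,L ∈ M_{n−1}(k), and write FS(M) = {(λ_i,a^i)}_{1≤i≤l} with a^i a partition of k_i. Then T_r^M degenerates to T_s^L if and only if one of the following holds: (1) r = s = 1 and FS(L) = {(λ_i,b^i)}_{1≤i≤l} for some partitions b^i of k_i with a^i ⪰ b^i for all i; (2) r = s = 0 and there exists α ∈ k∖{0} with FS(L) = {(αλ_i,b^i)}_{1≤i≤l} for some partitions b^i of k_i with a^i ⪰ b^i for all i; (3) s = 0 and FS(L) = {(0,b)} (i.e., L is nilpotent with Jordan type b) for some partition b of n−1 with Σ_{i=1}^l a^i ⪰ b. -/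

import Mathlib

open scoped BigOperators

noncomputable section

/-- The space of `n`-dimensional (nonassociative) algebra structures on `kⁿ`:
bilinear maps `kⁿ × kⁿ → kⁿ`. -/
abbrev AlgStr (k : Type*) [Field k] (n : ℕ) : Type _ :=
  (Fin n → k) →ₗ[k] (Fin n → k) →ₗ[k] (Fin n → k)

variable {k : Type*} [Field k]

/-- The algebra structure with prescribed structure constants `c`:
`μ(x, y) m = ∑ i, ∑ j, x i * y j * c i j m`. -/
def ofConst {n : ℕ} (c : Fin n → Fin n → Fin n → k) : AlgStr k n :=
  ∑ i, ∑ j,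
    ((LinearMap.mul k k).compl₁₂ (LinearMap.proj i) (LinearMap.proj j)).compr₂
      (LinearMap.toSpanSingleton k (Fin n → k) (c i j))

/-- The structure constants of an algebra structure in the standard basis. -/
def structConst {n : ℕ} (μ : AlgStr k n) : Fin n × Fin n × Fin n → k :=
  fun t => μ (Pi.single t.1 1) (Pi.single t.2.1 1) t.2.2

/-- A subset of `AlgStr k n` is Zariski closed if it is the common zero locus of a
family of polynomials in the structure constants. -/
def IsZariskiClosed {n : ℕ} (S : Set (AlgStr k n)) : Prop :=
  ∃ P : Set (MvPolynomial (Fin n × Fin n × Fin n) k),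
    ∀ μ : AlgStr k n, μ ∈ S ↔ ∀ p ∈ P, MvPolynomial.eval (structConst μ) p = 0

/-- The action of `GL(V)` on algebra structures: `(g • μ)(x,y) = g (μ (g⁻¹ x) (g⁻¹ y))`. -/
def transport {n : ℕ} (g : (Fin n → k) ≃ₗ[k] (Fin n → k)) (μ : AlgStr k n) :
    AlgStr k n :=
  ((μ.comp g.symm.toLinearMap).compl₂ g.symm.toLinearMap).compr₂ g.toLinearMap

/-- The `GL(V)`-orbit of an algebra structure; two structures represent isomorphic
algebras iff they lie in the same orbit. -/
def orbit {n : ℕ} (μ : AlgStr k n) : Set (AlgStr k n) :=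
  {χ | ∃ g : (Fin n → k) ≃ₗ[k] (Fin n → k), transport g μ = χ}

/-- The Zariski closure of a set of algebra structures. -/
def zclosure {n : ℕ} (S : Set (AlgStr k n)) : Set (AlgStr k n) :=
  {χ | ∀ T : Set (AlgStr k n), IsZariskiClosed T → S ⊆ T → χ ∈ T}

/-- `μ` degenerates to `χ` if `χ` lies in the Zariski closure of the orbit of `μ`. -/
def degenerates {n : ℕ} (μ χ : AlgStr k n) : Prop :=
  χ ∈ zclosure (orbit μ)

/-- A proper degeneration: additionally `χ` is not isomorphic to `μ`. -/
def properlyDegenerates {n : ℕ} (μ χ : AlgStr k n) : Prop :=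
  degenerates μ χ ∧ χ ∉ orbit μ

/-- There is a chain of `m` proper degenerations starting at `μ`. -/
def hasChain {n : ℕ} (μ : AlgStr k n) (m : ℕ) : Prop :=
  ∃ c : ℕ → AlgStr k n, c m = μ ∧ ∀ i < m, properlyDegenerates (c (i + 1)) (c i)

/-- The level of `μ` is `m`: there is a chain of `m` proper degenerations starting
at `μ` but no chain of `m+1`. -/
def levelIs {n : ℕ} (μ : AlgStr k n) (m : ℕ) : Prop :=
  hasChain μ m ∧ ¬ hasChain μ (m + 1)

/-- The subalgebra generated by a set `s`. -/
def subalgGen {n : ℕ} (μ : AlgStr k n) (s : Set (Fin n → k)) :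
    Submodule k (Fin n → k) :=
  sInf {W | s ⊆ W ∧ ∀ x ∈ W, ∀ y ∈ W, μ x y ∈ W}

/-- The generation type of `μ` is `m`: `m` is the maximal dimension of a
one-generated subalgebra. -/
def genType {n : ℕ} (μ : AlgStr k n) (m : ℕ) : Prop :=
  IsGreatest {d : ℕ | ∃ a : Fin n → k, Module.finrank k ↥(subalgGen μ {a}) = d} m

/-- A standard `1`-generated algebra: it admits a grading `A = ⊕_{i ≥ 1} A_i` with
`dim A_1 = 1`, `A_i A_j ⊆ A_{i+j}`, generated by `A_1` as an algebra. -/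
def StandardOneGenerated {m : ℕ} (μ : AlgStr k m) : Prop :=
  ∃ A : ℕ → Submodule k (Fin m → k),
    A 0 = ⊥ ∧ DirectSum.IsInternal A ∧ Module.finrank k ↥(A 1) = 1 ∧
    (∀ i j : ℕ, ∀ x ∈ A i, ∀ y ∈ A j, μ x y ∈ A (i + j)) ∧
    subalgGen μ ((A 1 : Submodule k (Fin m → k)) : Set (Fin m → k)) = ⊤

/-- Extension by zero of coordinates, `kᵐ → kⁿ`. -/
def inclMap (k : Type*) [Field k] {m n : ℕ} (h : m ≤ n) :
    (Fin m → k) →ₗ[k] (Fin n → k) where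
  toFun x i := if hi : (i : ℕ) < m then x ⟨i, hi⟩ else 0
  map_add' x y := by funext i; by_cases hi : (i : ℕ) < m <;> simp [hi]
  map_smul' a x := by funext i; by_cases hi : (i : ℕ) < m <;> simp [hi]

/-- The `n`-dimensional algebra `B ⊕ k^{n-m}` obtained from an `m`-dimensional
algebra `B` by adjoining a complement with all products zero. -/
def extendZero {m n : ℕ} (h : m ≤ n) (B : AlgStr k m) : AlgStr k n :=
  ((B.comp (LinearMap.funLeft k k (Fin.castLE h))).compl₂
      (LinearMap.funLeft k k (Fin.castLE h))).compr₂ (inclMap k h)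

/-- The `i`-th standard basis vector (as a plain function, `0` if `i ≥ n`). -/
def unitVec {k : Type*} [Field k] (n i : ℕ) : Fin n → k :=
  fun j => if (j : ℕ) = i then 1 else 0

/-- Projection onto the coordinate `0` part. -/
def proj0 (k : Type*) [Field k] (n : ℕ) : (Fin n → k) →ₗ[k] (Fin n → k) :=
  LinearMap.pi fun i => if (i : ℕ) = 0 then LinearMap.proj i else 0

/-- Projection onto the coordinates `≥ 1` part. -/
def projPos (k : Type*) [Field k] (n : ℕ) : (Fin n → k) →ₗ[k] (Fin n → k) :=
  LinearMap.pi fun i => if (i : ℕ) = 0 then 0 else LinearMap.proj i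

/-- The Inönü–Wigner contraction of `μ` with respect to the `1`-dimensional
subalgebra spanned by the first basis vector (the remaining coordinates form the
square-zero ideal part). -/
def IWcontract0 {n : ℕ} (μ : AlgStr k n) : AlgStr k n :=
  ((μ.comp (projPos k n)).compl₂ (proj0 k n)).compr₂ (projPos k n) +
    ((μ.comp (proj0 k n)).compl₂ (projPos k n)).compr₂ (projPos k n) +
    (μ.comp (proj0 k n)).compl₂ (proj0 k n)

/-- The annihilator of an algebra structure. -/
def annihilator {n : ℕ} (μ : AlgStr k n) : Submodule k (Fin n → k) where
  carrier := {a | ∀ b, μ a b = 0 ∧ μ b a = 0}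
  add_mem' := by
    intro a b ha hb
    intro c
    constructor
    · rw [map_add, LinearMap.add_apply, (ha c).1, (hb c).1, add_zero]
    · rw [map_add, (ha c).2, (hb c).2, add_zero]
  zero_mem' := by
    intro b
    constructor
    · rw [map_zero, LinearMap.zero_apply]
    · rw [map_zero]
  smul_mem' := by
    intro t a ha b
    constructor
    · rw [map_smul, LinearMap.smul_apply, (ha b).1, smul_zero]
    · rw [map_smul, (ha b).2, smul_zero]

/-- `μ` has a square-zero (two-sided) ideal of codimension `1`. -/
def hasSqZeroIdealCodim1 {n : ℕ} (μ : AlgStr k n) : Prop :=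
  ∃ I : Submodule k (Fin n → k), Module.finrank k ↥I = n - 1 ∧
    (∀ x ∈ I, ∀ y : Fin n → k, μ x y ∈ I ∧ μ y x ∈ I) ∧
    ∀ x ∈ I, ∀ y ∈ I, μ x y = 0

/-- `a` (viewed as the sequence of parts `a 0 ≥ a 1 ≥ …`) is a partition of `N`. -/
def IsPartitionOf (a : ℕ → ℕ) (N : ℕ) : Prop :=
  (∀ i j : ℕ, i ≤ j → a j ≤ a i) ∧
    ∃ l : ℕ, (∀ i, l ≤ i → a i = 0) ∧ ∑ i ∈ Finset.range l, a i = N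

/-- The dominance order on partitions: `a ⪰ b`. -/
def Dominates (a b : ℕ → ℕ) : Prop :=
  ∀ m : ℕ, ∑ i ∈ Finset.range m, b i ≤ ∑ i ∈ Finset.range m, a i

/-- `a` is the Jordan type of the matrix `M` at the eigenvalue `lam`:
`a` is a partition of the generalized eigenspace dimension, and the parts of `a`
are the sizes of the Jordan blocks of `M` with eigenvalue `lam`, expressed via
the ranks of powers of `M - lam • 1`. -/
def IsJordanTypeAt {N : ℕ} (M : Matrix (Fin N) (Fin N) k) (lam : k) (a : ℕ → ℕ) :
    Prop :=
  IsPartitionOf a (N - ((M - lam • (1 : Matrix (Fin N) (Fin N) k)) ^ N).rank) ∧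
    ∀ p : ℕ, ((M - lam • (1 : Matrix (Fin N) (Fin N) k)) ^ p).rank =
      N - ∑ i ∈ Finset.range N, min (a i) p

/-- The full specter of `M` is `{(lam i, a i)}`: the `lam i` are pairwise distinct,
each `a i` is the (nonempty) Jordan type of `M` at `lam i`, and every eigenvalue
of `M` occurs among the `lam i`. -/
def IsFullSpecter {N : ℕ} (M : Matrix (Fin N) (Fin N) k) {l : ℕ}
    (lam : Fin l → k) (a : Fin l → ℕ → ℕ) : Prop :=
  Function.Injective lam ∧
    (∀ i, IsJordanTypeAt M (lam i) (a i) ∧ a i 0 ≠ 0) ∧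
    ∀ c : k, (∃ v : Fin N → k, v ≠ 0 ∧ M.mulVec v = c • v) → ∃ i, lam i = c

/-- There is a chain of `len` strict dominance steps of partitions of `N`
starting (on top) at `a`. -/
def partChain (a : ℕ → ℕ) (N len : ℕ) : Prop :=
  ∃ c : ℕ → ℕ → ℕ, (∀ i ≤ len, IsPartitionOf (c i) N) ∧ c len = a ∧
    ∀ i < len, Dominates (c (i + 1)) (c i) ∧ c (i + 1) ≠ c i

/-- The structure `T_α^M ∈ A_{m+1}`. -/
def Tstr {m : ℕ} (α : k) (M : Matrix (Fin m) (Fin m) k) : AlgStr k (m + 1) :=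
  ofConst fun i j mm =>
    if hi : i = 0 then
      if hj : j = 0 then (if mm = 0 then α else 0)
      else if hmm : mm = 0 then 0 else M (mm.pred hmm) (j.pred hj)
    else if hj : j = 0 then
      if hmm : mm = 0 then 0 else (if i = mm then α else 0) - M (mm.pred hmm) (i.pred hi)
    else 0

/-- The trivial singular extension `k^{n-2} ⋊_{(L₁,R₁,L₂,R₂)} χ` of the
`2`-dimensional algebra `χ` given by the coefficients `c11, c12, c21, d12, d21, d22`
(with `χ(e₁,e₁) = c11·e₁ + e₂`, `χ(e₁,e₂) = c12·e₁ + d12·e₂`,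
`χ(e₂,e₁) = c21·e₁ + d21·e₂`, `χ(e₂,e₂) = d22·e₂`). -/
def sdExt {m : ℕ} (c11 c12 c21 d12 d21 d22 : k)
    (L1 R1 L2 R2 : Matrix (Fin m) (Fin m) k) : AlgStr k (m + 2) :=
  ofConst fun i j mm =>
    if hi0 : (i : ℕ) = 0 then
      if hj0 : (j : ℕ) = 0 then
        if (mm : ℕ) = 0 then c11 else if (mm : ℕ) = 1 then 1 else 0
      else if hj1 : (j : ℕ) = 1 then
        if (mm : ℕ) = 0 then c12 else if (mm : ℕ) = 1 then d12 else 0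
      else if hmm : (mm : ℕ) < 2 then 0
      else L1 ⟨(mm : ℕ) - 2, by have := mm.isLt; omega⟩
             ⟨(j : ℕ) - 2, by have := j.isLt; omega⟩
    else if hi1 : (i : ℕ) = 1 then
      if hj0 : (j : ℕ) = 0 then
        if (mm : ℕ) = 0 then c21 else if (mm : ℕ) = 1 then d21 else 0
      else if hj1 : (j : ℕ) = 1 then
        if (mm : ℕ) = 1 then d22 else 0
      else if hmm : (mm : ℕ) < 2 then 0
      else L2 ⟨(mm : ℕ) - 2, by have := mm.isLt; omega⟩
             ⟨(j : ℕ) - 2, by have := j.isLt; omega⟩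
    else
      if hj0 : (j : ℕ) = 0 then
        if hmm : (mm : ℕ) < 2 then 0
        else R1 ⟨(mm : ℕ) - 2, by have := mm.isLt; omega⟩
               ⟨(i : ℕ) - 2, by have := i.isLt; omega⟩
      else if hj1 : (j : ℕ) = 1 then
        if hmm : (mm : ℕ) < 2 then 0
        else R2 ⟨(mm : ℕ) - 2, by have := mm.isLt; omega⟩
               ⟨(i : ℕ) - 2, by have := i.isLt; omega⟩
      else 0

/-! Concrete algebra structures, given by multiplication tables on the standard
basis `e₁, …, eₙ` (0-indexed as `0, …, n-1`); all unspecified products are zero. -/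

/-- `A₃ ⊕ k^{n-2}`: `e₁e₁ = e₂`. -/
def A3str (n : ℕ) : AlgStr k n :=
  ofConst fun i j m => if (i : ℕ) = 0 ∧ (j : ℕ) = 0 ∧ (m : ℕ) = 1 then 1 else 0

/-- `n₃ ⊕ k^{n-3}`: `e₁e₂ = e₃`, `e₂e₁ = -e₃`. -/
def n3str (n : ℕ) : AlgStr k n :=
  ofConst fun i j m =>
    if (i : ℕ) = 0 ∧ (j : ℕ) = 1 ∧ (m : ℕ) = 2 then 1
    else if (i : ℕ) = 1 ∧ (j : ℕ) = 0 ∧ (m : ℕ) = 2 then -1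
    else 0

/-- `p⁻`: `e₁eᵢ = eᵢ`, `eᵢe₁ = -eᵢ` for `i ≥ 2`. -/
def pminusStr (n : ℕ) : AlgStr k n :=
  ofConst fun i j m =>
    if (i : ℕ) = 0 ∧ 1 ≤ (j : ℕ) ∧ m = j then 1
    else if 1 ≤ (i : ℕ) ∧ (j : ℕ) = 0 ∧ m = i then -1
    else 0

/-- `ν^α`: `e₁e₁ = e₁`, `e₁eᵢ = α eᵢ`, `eᵢe₁ = (1-α) eᵢ` for `i ≥ 2`. -/
def nuStr (n : ℕ) (α : k) : AlgStr k n :=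
  ofConst fun i j m =>
    if (i : ℕ) = 0 then
      if (j : ℕ) = 0 then (if (m : ℕ) = 0 then 1 else 0)
      else (if m = j then α else 0)
    else if (j : ℕ) = 0 then (if m = i then 1 - α else 0)
    else 0

/-- `k^{n-2} ⋊ E₄`: `e₁e₁ = e₁`, `e₁e₂ = e₁ + e₂`, `e₂e₂ = e₂`,
`e₁eᵢ = eᵢ`, `eᵢe₂ = eᵢ` for `i ≥ 3`.  (For `n = 2` this is `E₄`.) -/
def kE4str (n : ℕ) : AlgStr k n :=
  ofConst fun i j m =>
    if (i : ℕ) = 0 ∧ (j : ℕ) = 0 then (if (m : ℕ) = 0 then 1 else 0)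
    else if (i : ℕ) = 0 ∧ (j : ℕ) = 1 then (if (m : ℕ) = 0 ∨ (m : ℕ) = 1 then 1 else 0)
    else if (i : ℕ) = 1 ∧ (j : ℕ) = 1 then (if (m : ℕ) = 1 then 1 else 0)
    else if (i : ℕ) = 0 ∧ 2 ≤ (j : ℕ) then (if m = j then 1 else 0)
    else if 2 ≤ (i : ℕ) ∧ (j : ℕ) = 1 then (if m = i then 1 else 0)
    else 0

/-- `T₀^{2,(α,β)}`: `e₁e₂ = αe₂ + e₃`, `e₂e₁ = -αe₂ - e₃`,
`e₁eᵢ = βeᵢ`, `eᵢe₁ = -βeᵢ` for `i ≥ 3`. -/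
def T02str (n : ℕ) (α β : k) : AlgStr k n :=
  ofConst fun i j m =>
    if (i : ℕ) = 0 ∧ (j : ℕ) = 1 then
      (if (m : ℕ) = 1 then α else if (m : ℕ) = 2 then 1 else 0)
    else if (i : ℕ) = 1 ∧ (j : ℕ) = 0 then
      (if (m : ℕ) = 1 then -α else if (m : ℕ) = 2 then -1 else 0)
    else if (i : ℕ) = 0 ∧ 2 ≤ (j : ℕ) then (if m = j then β else 0)
    else if 2 ≤ (i : ℕ) ∧ (j : ℕ) = 0 then (if m = i then -β else 0)
    else 0

/-- `T₁^{2,(α,β)}`: `e₁e₁ = e₁`, `e₁e₂ = αe₂ + e₃`, `e₂e₁ = (1-α)e₂ - e₃`,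
`e₁eᵢ = βeᵢ`, `eᵢe₁ = (1-β)eᵢ` for `i ≥ 3`. -/
def T12str (n : ℕ) (α β : k) : AlgStr k n :=
  ofConst fun i j m =>
    if (i : ℕ) = 0 ∧ (j : ℕ) = 0 then (if (m : ℕ) = 0 then 1 else 0)
    else if (i : ℕ) = 0 ∧ (j : ℕ) = 1 then
      (if (m : ℕ) = 1 then α else if (m : ℕ) = 2 then 1 else 0)
    else if (i : ℕ) = 1 ∧ (j : ℕ) = 0 then
      (if (m : ℕ) = 1 then 1 - α else if (m : ℕ) = 2 then -1 else 0)
    else if (i : ℕ) = 0 ∧ 2 ≤ (j : ℕ) then (if m = j then β else 0)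
    else if 2 ≤ (i : ℕ) ∧ (j : ℕ) = 0 then (if m = i then 1 - β else 0)
    else 0

/-- `T₀³`: `e₁e₂ = e₃`, `e₂e₁ = -e₃`, `e₁e₃ = e₄`, `e₃e₁ = -e₄`. -/
def T03str (n : ℕ) : AlgStr k n :=
  ofConst fun i j m =>
    if (i : ℕ) = 0 ∧ (j : ℕ) = 1 ∧ (m : ℕ) = 2 then 1
    else if (i : ℕ) = 1 ∧ (j : ℕ) = 0 ∧ (m : ℕ) = 2 then -1
    else if (i : ℕ) = 0 ∧ (j : ℕ) = 2 ∧ (m : ℕ) = 3 then 1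
    else if (i : ℕ) = 2 ∧ (j : ℕ) = 0 ∧ (m : ℕ) = 3 then -1
    else 0

/-- `T₀^{2,2}`: `e₁e₂ = e₃`, `e₂e₁ = -e₃`, `e₁e₄ = e₅`, `e₄e₁ = -e₅`. -/
def T022str (n : ℕ) : AlgStr k n :=
  ofConst fun i j m =>
    if (i : ℕ) = 0 ∧ (j : ℕ) = 1 ∧ (m : ℕ) = 2 then 1
    else if (i : ℕ) = 1 ∧ (j : ℕ) = 0 ∧ (m : ℕ) = 2 then -1
    else if (i : ℕ) = 0 ∧ (j : ℕ) = 3 ∧ (m : ℕ) = 4 then 1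
    else if (i : ℕ) = 3 ∧ (j : ℕ) = 0 ∧ (m : ℕ) = 4 then -1
    else 0

/-- `η_l ⊕ k^{n-2l-1}`: `e_{2i-1}e_{2i} = e_{2l+1}`, `e_{2i}e_{2i-1} = -e_{2l+1}`
for `1 ≤ i ≤ l`. -/
def etaStr (n l : ℕ) : AlgStr k n :=
  ofConst fun i j m =>
    if (i : ℕ) % 2 = 0 ∧ (j : ℕ) = (i : ℕ) + 1 ∧ (i : ℕ) < 2 * l ∧ (m : ℕ) = 2 * l then 1
    else if (j : ℕ) % 2 = 0 ∧ (i : ℕ) = (j : ℕ) + 1 ∧ (j : ℕ) < 2 * l ∧ (m : ℕ) = 2 * l then -1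
    else 0

/-- `F^{α,β} ⊕ k^{n-3}`: `e₁e₁ = e₃`, `e₁e₂ = αe₃`, `e₂e₁ = βe₃`. -/
def FabStr (n : ℕ) (α β : k) : AlgStr k n :=
  ofConst fun i j m =>
    if (i : ℕ) = 0 ∧ (j : ℕ) = 0 ∧ (m : ℕ) = 2 then 1
    else if (i : ℕ) = 0 ∧ (j : ℕ) = 1 ∧ (m : ℕ) = 2 then α
    else if (i : ℕ) = 1 ∧ (j : ℕ) = 0 ∧ (m : ℕ) = 2 then β
    else 0

/-- `k^{n-2} ⋊ A₃`: `e₁e₁ = e₂`, `e₁eᵢ = eᵢ`, `eᵢe₁ = -eᵢ` for `i ≥ 3`. -/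
def kA3str (n : ℕ) : AlgStr k n :=
  ofConst fun i j m =>
    if (i : ℕ) = 0 ∧ (j : ℕ) = 0 ∧ (m : ℕ) = 1 then 1
    else if (i : ℕ) = 0 ∧ 2 ≤ (j : ℕ) then (if m = j then 1 else 0)
    else if 2 ≤ (i : ℕ) ∧ (j : ℕ) = 0 then (if m = i then -1 else 0)
    else 0

/-- `k² ⋊_{α,β} A₃ ⊕ k^{n-4}`: `e₁e₁ = e₂`, `e₁e₃ = αe₄`, `e₃e₁ = βe₄`. -/
def k2A3str (n : ℕ) (α β : k) : AlgStr k n :=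
  ofConst fun i j m =>
    if (i : ℕ) = 0 ∧ (j : ℕ) = 0 ∧ (m : ℕ) = 1 then 1
    else if (i : ℕ) = 0 ∧ (j : ℕ) = 2 ∧ (m : ℕ) = 3 then α
    else if (i : ℕ) = 2 ∧ (j : ℕ) = 0 ∧ (m : ℕ) = 3 then β
    else 0

/-- `k^{n-2} ⋊_α A₁^α`: `e₁e₁ = e₁ + e₂`, `e₁eᵢ = αeᵢ`, `eᵢe₁ = (1-α)eᵢ` for `i ≥ 2`. -/
def kA1str (n : ℕ) (α : k) : AlgStr k n :=
  ofConst fun i j m =>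
    if (i : ℕ) = 0 ∧ (j : ℕ) = 0 then (if (m : ℕ) = 0 ∨ (m : ℕ) = 1 then 1 else 0)
    else if (i : ℕ) = 0 then (if m = j then α else 0)
    else if (j : ℕ) = 0 then (if m = i then 1 - α else 0)
    else 0

/-- `k^{n-2} ⋊₁ A₂`: `e₁e₁ = e₂`, `e₁eᵢ = eᵢ`, `eᵢe₁ = -eᵢ` for `i ≥ 2`. -/
def kA2str (n : ℕ) : AlgStr k n :=
  ofConst fun i j m =>
    if (i : ℕ) = 0 ∧ (j : ℕ) = 0 then (if (m : ℕ) = 1 then 1 else 0)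
    else if (i : ℕ) = 0 then (if m = j then 1 else 0)
    else if (j : ℕ) = 0 then (if m = i then -1 else 0)
    else 0

/-- `k^{n-2} ⋊₀ᵗ B₂^α`: `e₁eᵢ = αeᵢ`, `eᵢe₁ = (1-α)eᵢ` for `i ≥ 2`. -/
def ktB2str (n : ℕ) (α : k) : AlgStr k n :=
  ofConst fun i j m =>
    if (i : ℕ) = 0 ∧ 1 ≤ (j : ℕ) then (if m = j then α else 0)
    else if 1 ≤ (i : ℕ) ∧ (j : ℕ) = 0 then (if m = i then 1 - α else 0)
    else 0

/-- `k^{n-2} ⋊₀ᵗ D₂^{α,β}`: `e₁e₁ = e₁`, `e₁eᵢ = αeᵢ`, `eᵢe₁ = βeᵢ` for `i ≥ 2`. -/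
def ktD2str (n : ℕ) (α β : k) : AlgStr k n :=
  ofConst fun i j m =>
    if (i : ℕ) = 0 ∧ (j : ℕ) = 0 then (if (m : ℕ) = 0 then 1 else 0)
    else if (i : ℕ) = 0 then (if m = j then α else 0)
    else if (j : ℕ) = 0 then (if m = i then β else 0)
    else 0
section Partitions

theorem sum_range_le_mul_add_sum_tsub (a : ℕ → ℕ) (T p m : ℕ) (hm : m ≤ T) :
    ∑ t ∈ Finset.range m, a t ≤ m * p + ∑ t ∈ Finset.range T, (a t - p) := by
  calc ∑ t ∈ Finset.range m, a t ≤ ∑ t ∈ Finset.range m, (p + (a t - p)) :=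
        Finset.sum_le_sum fun t _ => by omega
    _ = m * p + ∑ t ∈ Finset.range m, (a t - p) := by
        rw [Finset.sum_add_distrib]; simp
    _ ≤ _ := by
        gcongr

theorem sum_range_eq_mul_add_sum_tsub (a : ℕ → ℕ) (T p m : ℕ) (hm : m ≤ T)
    (h1 : ∀ t < m, p ≤ a t) (h2 : ∀ t, m ≤ t → a t ≤ p) :
    ∑ t ∈ Finset.range m, a t = m * p + ∑ t ∈ Finset.range T, (a t - p) := by
  have e : ∑ t ∈ Finset.range T, (a t - p) = ∑ t ∈ Finset.range m, (a t - p) := by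
    symm
    apply Finset.sum_subset (Finset.range_mono hm)
    intro t _ ht
    have := h2 t (by simpa using ht)
    omega
  calc ∑ t ∈ Finset.range m, a t = ∑ t ∈ Finset.range m, (p + (a t - p)) :=
        Finset.sum_congr rfl fun t ht => by
          have := h1 t (by simpa using ht)
          omega
    _ = m * p + ∑ t ∈ Finset.range m, (a t - p) := by
        rw [Finset.sum_add_distrib]; simp
    _ = _ := by rw [e]

theorem sum_min_add_sum_tsub (a : ℕ → ℕ) (T p : ℕ) :
    ∑ t ∈ Finset.range T, min (a t) p + ∑ t ∈ Finset.range T, (a t - p) =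
      ∑ t ∈ Finset.range T, a t := by
  rw [← Finset.sum_add_distrib]
  exact Finset.sum_congr rfl fun t _ => by omega

theorem sum_min_le_of_dominates {a b : ℕ → ℕ} {T : ℕ} (hb : Antitone b)
    (hbT : ∀ t, T ≤ t → b t = 0)
    (hab : ∑ t ∈ Finset.range T, a t = ∑ t ∈ Finset.range T, b t)
    (h : ∀ m, ∑ i ∈ Finset.range m, b i ≤ ∑ i ∈ Finset.range m, a i) (p : ℕ) :
    ∑ t ∈ Finset.range T, min (a t) p ≤ ∑ t ∈ Finset.range T, min (b t) p := by
  obtain ⟨m, hm, h1, h2⟩ : ∃ m ≤ T, (∀ t < m, p ≤ b t) ∧ ∀ t, m ≤ t → b t ≤ p := by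
    have hex : ∃ m, b m ≤ p := ⟨T, by rw [hbT T le_rfl]; exact Nat.zero_le _⟩
    classical
    refine ⟨Nat.find hex, Nat.find_min' hex (by rw [hbT T le_rfl]; exact Nat.zero_le _), ?_, ?_⟩
    · intro t ht
      have := Nat.find_min hex ht
      omega
    · intro t ht
      exact (hb ht).trans (Nat.find_spec hex)
  have e1 := sum_range_eq_mul_add_sum_tsub b T p m hm h1 h2
  have e2 := sum_range_le_mul_add_sum_tsub a T p m hm
  have e3 := h m
  have e4 := sum_min_add_sum_tsub a T p
  have e5 := sum_min_add_sum_tsub b T p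
  omega

theorem dominates_of_sum_min_le {a b : ℕ → ℕ} {T : ℕ} (ha : Antitone a)
    (haT : ∀ t, T ≤ t → a t = 0) (hbT : ∀ t, T ≤ t → b t = 0)
    (hab : ∑ t ∈ Finset.range T, a t = ∑ t ∈ Finset.range T, b t)
    (h : ∀ p, ∑ t ∈ Finset.range T, min (a t) p ≤ ∑ t ∈ Finset.range T, min (b t) p) (m : ℕ) :
    ∑ i ∈ Finset.range m, b i ≤ ∑ i ∈ Finset.range m, a i := by
  rcases le_total m T with hm | hm
  · have e1 := sum_range_eq_mul_add_sum_tsub a T (a m) m hm (fun t ht => ha ht.le)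
      (fun t ht => ha ht)
    have e2 := sum_range_le_mul_add_sum_tsub b T (a m) m hm
    have e3 := h (a m)
    have e4 := sum_min_add_sum_tsub a T (a m)
    have e5 := sum_min_add_sum_tsub b T (a m)
    omega
  · have e : ∀ c : ℕ → ℕ, (∀ t, T ≤ t → c t = 0) →
        ∑ t ∈ Finset.range T, c t = ∑ t ∈ Finset.range m, c t := fun c hc =>
      Finset.sum_subset (Finset.range_mono hm) fun t _ ht => hc t (by simpa using ht)
    rw [← e a haT, ← e b hbT, hab]

theorem exists_list_count_eq {ι : Type*} [Fintype ι] [DecidableEq ι] (c : ι → ℕ) :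
    ∃ w : List ι, ∀ i, w.count i = c i := by
  refine ⟨(∑ i, Multiset.replicate (c i) i).toList, fun i => ?_⟩
  rw [← Multiset.coe_count, Multiset.coe_toList, Multiset.count_sum']
  simp [Multiset.count_replicate]

theorem exists_list_prefixes_count_eq {ι : Type*} [Fintype ι] [DecidableEq ι] (T : ℕ) :
    ∀ a : ℕ → ι → ℕ, Antitone a → a T = 0 →
      ∃ w : List ι, (∀ i, w.count i = a 0 i) ∧ ∀ t, ∃ u, u <+: w ∧ ∀ i, u.count i = a t i := by
  induction T with
  | zero =>
    intro a ha h0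
    refine ⟨[], fun i => by simp [h0], fun t => ⟨[], List.prefix_rfl, fun i => ?_⟩⟩
    have := ha (Nat.zero_le t) i
    simp only [h0, Pi.zero_apply, List.count_nil] at *
    omega
  | succ T ih =>
    intro a ha h0
    obtain ⟨w, hw, hp⟩ := ih (fun t => a (t + 1)) (fun s t h => ha (by omega)) h0
    obtain ⟨u, hu⟩ := exists_list_count_eq fun i => a 0 i - a 1 i
    have hc : ∀ i, (w ++ u).count i = a 0 i := fun i => by
      have := ha (Nat.zero_le 1) i
      rw [List.count_append, hw, hu]
      simp only [zero_add] at *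
      omega
    refine ⟨w ++ u, hc, fun t => ?_⟩
    cases t with
    | zero => exact ⟨w ++ u, List.prefix_rfl, hc⟩
    | succ t =>
      obtain ⟨v, hv, hv'⟩ := hp t
      exact ⟨v, hv.trans (List.prefix_append _ _), hv'⟩

theorem card_filter_getD_eq_count_take {ι : Type*} [DecidableEq ι] (w : List ι) (d i : ι) (p : ℕ)
    (hp : p ≤ w.length) :
    ((Finset.range p).filter fun j => w.getD j d = i).card = (w.take p).count i := by
  induction p with
  | zero => simp
  | succ p ih =>
    rw [Finset.range_add_one, Finset.filter_insert, List.take_succ_eq_append_getElem (by omega),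
      List.count_append, ← ih (by omega), List.getD_eq_getElem _ _ (by omega)]
    split_ifs with h
    · rw [Finset.card_insert_of_notMem (by simp), List.count_singleton]
      simp [h]
    · rw [List.count_singleton]
      simp [h]

theorem sum_card_filter_range_eq {ι : Type*} [Fintype ι] [DecidableEq ι] (w : ℕ → ι) (p : ℕ) :
    ∑ i, ((Finset.range p).filter fun j => w j = i).card = p := by
  have := Finset.card_eq_sum_card_fiberwise (s := Finset.range p) (t := Finset.univ) (f := w)
    (fun _ _ => Finset.mem_coe.2 (Finset.mem_univ _))
  simpa using this.symm

/-- A decreasing chain of vectors of naturals lies on a monotone lattice path. -/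
theorem exists_path {ι : Type*} [Fintype ι] [DecidableEq ι] [Nonempty ι] (T : ℕ)
    (a : ℕ → ι → ℕ) (ha : Antitone a) (h0 : a T = 0) :
    ∃ w : ℕ → ι, ∀ t p, ∑ i, min (a t i) ((Finset.range p).filter fun j => w j = i).card =
      min (∑ i, a t i) p := by
  obtain ⟨w, hw, hp⟩ := exists_list_prefixes_count_eq T a ha h0
  have d : ι := Classical.arbitrary ι
  refine ⟨fun j => w.getD j d, fun t p => ?_⟩
  obtain ⟨u, hu, hc⟩ := hp t
  have hlen : u.length = ∑ i, a t i := by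
    rw [← Finset.sum_congr rfl fun i _ => hc i]
    simpa using (Multiset.sum_count_eq_card (s := Finset.univ) (m := (u : Multiset ι))
      (fun _ _ => Finset.mem_univ _)).symm
  have hat : ∀ i, ((Finset.range u.length).filter fun j => w.getD j d = i).card = a t i := by
    intro i
    rw [card_filter_getD_eq_count_take _ _ _ _ hu.length_le, ← hc,
      ← List.prefix_iff_eq_take.1 hu]
  rcases le_total p u.length with h | h
  · rw [min_eq_right (hlen ▸ h), ← sum_card_filter_range_eq (fun j => w.getD j d) p]
    refine Finset.sum_congr rfl fun i _ => ?_
    rw [sum_card_filter_range_eq, min_eq_right]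
    rw [← hat]
    exact Finset.card_le_card (Finset.filter_subset_filter _ (Finset.range_mono h))
  · rw [min_eq_left (hlen ▸ h)]
    refine Finset.sum_congr rfl fun i _ => min_eq_left ?_
    rw [← hat]
    exact Finset.card_le_card (Finset.filter_subset_filter _ (Finset.range_mono h))

end Partitions
section Kernels

open Module

variable {V W : Type*} [AddCommGroup V] [Module k V] [FiniteDimensional k V]
  [AddCommGroup W] [Module k W]

theorem finrank_comap_eq (g : V →ₗ[k] W) (U : Submodule k W) :
    finrank k (U.comap g) = finrank k (LinearMap.ker g) + finrank k ↥(U ⊓ LinearMap.range g) := by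
  have h := (g.domRestrict (U.comap g)).finrank_range_add_finrank_ker
  have h1 : LinearMap.range (g.domRestrict (U.comap g)) = U ⊓ LinearMap.range g := by
    rw [LinearMap.range_domRestrict, Submodule.map_comap_eq, inf_comm]
  have h2 : LinearMap.ker (g.domRestrict (U.comap g)) =
      (LinearMap.ker g).comap (U.comap g).subtype := by
    ext x; simp
  have h3 : finrank k ((LinearMap.ker g).comap (U.comap g).subtype) =
      finrank k (LinearMap.ker g) := by
    refine (Submodule.comapSubtypeEquivOfLe ?_).finrank_eq
    exact fun x hx => by
      have hx' : g x = 0 := hx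
      simp [hx']
  rw [h1, h2, h3] at h
  omega

/-- The increments of the dimensions of the kernels of the powers of `f`. -/
def kerIncr (f : End k V) (p : ℕ) : ℕ := finrank k ↥(LinearMap.ker f ⊓ LinearMap.range (f ^ p))

theorem finrank_ker_pow_succ (f : End k V) (p : ℕ) :
    finrank k (LinearMap.ker (f ^ (p + 1))) = finrank k (LinearMap.ker (f ^ p)) + kerIncr f p := by
  rw [kerIncr, ← finrank_comap_eq, ← LinearMap.ker_comp, ← End.mul_eq_comp, ← pow_succ']

theorem range_pow_antitone {V : Type*} [AddCommGroup V] [Module k V] (f : End k V) {p q : ℕ} (h : p ≤ q) :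
    LinearMap.range (f ^ q) ≤ LinearMap.range (f ^ p) := by
  obtain ⟨r, rfl⟩ := Nat.exists_eq_add_of_le h
  rw [pow_add]
  exact LinearMap.range_comp_le_range _ _

theorem kerIncr_antitone (f : End k V) : Antitone (kerIncr f) := fun _ _ h =>
  Submodule.finrank_mono (inf_le_inf_left _ (range_pow_antitone f h))

theorem finrank_ker_pow (f : End k V) (p : ℕ) :
    finrank k (LinearMap.ker (f ^ p)) = ∑ q ∈ Finset.range p, kerIncr f q := by
  induction p with
  | zero => simp [End.one_eq_id]
  | succ p ih => rw [finrank_ker_pow_succ, ih, Finset.sum_range_succ]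

theorem sum_card_filter_lt (c : ℕ → ℕ) (hc : Antitone c) (T P p : ℕ) (hT : c 0 ≤ T)
    (hp : p ≤ P) :
    ∑ t ∈ Finset.range T, min ((Finset.range P).filter fun q => t < c q).card p =
      ∑ q ∈ Finset.range p, c q := by
  have h1 : ∀ t, min ((Finset.range P).filter fun q => t < c q).card p =
      ((Finset.range p).filter fun q => t < c q).card := by
    intro t
    have hsub : (Finset.range p).filter (fun q => t < c q) ⊆
      (Finset.range P).filter fun q => t < c q :=
        Finset.filter_subset_filter _ (Finset.range_mono hp)
    by_cases h : ∀ q < p, t < c q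
    · have e : (Finset.range p).filter (fun q => t < c q) = Finset.range p :=
        Finset.filter_true_of_mem fun q hq => h q (by simpa using hq)
      have := Finset.card_le_card hsub
      rw [e] at this ⊢
      simp only [Finset.card_range] at *
      omega
    · push Not at h
      obtain ⟨q0, hq0, hq0'⟩ := h
      have e : (Finset.range P).filter (fun q => t < c q) =
          (Finset.range p).filter fun q => t < c q := by
        refine Finset.Subset.antisymm (fun q hq => ?_) hsub
        simp only [Finset.mem_filter, Finset.mem_range] at hq ⊢
        refine ⟨?_, hq.2⟩
        by_contra hqp
        have := hc (show q0 ≤ q by omega)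
        omega
      rw [e, min_eq_left]
      simpa using Finset.card_filter_le (Finset.range p) fun q => t < c q
  simp_rw [h1, Finset.card_filter]
  rw [Finset.sum_comm]
  refine Finset.sum_congr rfl fun q _ => ?_
  have := hc (Nat.zero_le q)
  rw [← Finset.card_filter]
  have : (Finset.range T).filter (fun t => t < c q) = Finset.range (c q) := by
    ext t; simp; omega
  rw [this, Finset.card_range]

/-- Existence of the Jordan type of `f` at `0`. -/
theorem exists_jordan_partition (f : End k V) :
    ∃ b : ℕ → ℕ, Antitone b ∧ (∀ t, finrank k V ≤ t → b t = 0) ∧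
      ∀ p, finrank k (LinearMap.ker (f ^ p)) = ∑ t ∈ Finset.range (finrank k V), min (b t) p := by
  set N := finrank k V
  have hN : ∀ q, kerIncr f q ≤ N := fun q => Submodule.finrank_le _
  set b : ℕ → ℕ := fun t => ((Finset.range N).filter fun q => t < kerIncr f q).card with hb
  have hbN : ∀ t, b t ≤ N := fun t => by
    simpa using Finset.card_filter_le (Finset.range N) fun q => t < kerIncr f q
  have key : ∀ p ≤ N, finrank k (LinearMap.ker (f ^ p)) =
      ∑ t ∈ Finset.range N, min (b t) p := fun p hp => by
    rw [finrank_ker_pow, ← sum_card_filter_lt _ (kerIncr_antitone f) N N p (hN 0) hp]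
  refine ⟨b, fun s t h => ?_, fun t ht => ?_, fun p => ?_⟩
  · exact Finset.card_le_card fun q hq => by
      simp only [Finset.mem_filter] at hq ⊢
      exact ⟨hq.1, by omega⟩
  · rw [Finset.card_eq_zero, Finset.filter_eq_empty_iff]
    intro q _
    have := hN q
    omega
  · rcases le_total p N with h | h
    · exact key p h
    · rw [End.ker_pow_eq_ker_pow_finrank_of_le h, key N le_rfl]
      refine Finset.sum_congr rfl fun t _ => ?_
      have := hbN t
      omega

open Polynomial in
theorem finrank_ker_aeval_prod (f : End k V) {ι : Type*} (s : Finset ι) (q : ι → k[X])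
    (hq : ∀ i ∈ s, ∀ j ∈ s, i ≠ j → IsCoprime (q i) (q j)) :
    finrank k (LinearMap.ker (aeval f (∏ i ∈ s, q i))) =
      ∑ i ∈ s, finrank k (LinearMap.ker (aeval f (q i))) := by
  classical
  induction s using Finset.induction_on with
  | empty =>
    rw [Finset.prod_empty, map_one, End.one_eq_id, LinearMap.ker_id]
    simp
  | insert i s hi ih =>
    have hco : IsCoprime (q i) (∏ j ∈ s, q j) := IsCoprime.prod_right fun j hj =>
      hq i (by simp) j (by simp [hj]) (by rintro rfl; exact hi hj)
    rw [Finset.prod_insert hi, Finset.sum_insert hi,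
      ← ih fun a ha b hb => hq a (by simp [ha]) b (by simp [hb]),
      ← sup_ker_aeval_eq_ker_aeval_mul_of_coprime f hco, ← Submodule.finrank_sup_add_finrank_inf_eq,
      (disjoint_ker_aeval_of_isCoprime f hco).eq_bot]
    simp

end Kernels
section Flags

open Module

variable {V : Type*} [AddCommGroup V] [Module k V] [FiniteDimensional k V]

theorem exists_finrank_eq_between {A B : Submodule k V} (hAB : A ≤ B) {c : ℕ}
    (hA : finrank k A ≤ c) (hB : c ≤ finrank k B) :
    ∃ U : Submodule k V, A ≤ U ∧ U ≤ B ∧ finrank k U = c := by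
  induction c, hA using Nat.le_induction with
  | base => exact ⟨A, le_rfl, hAB, rfl⟩
  | succ c hc ih =>
    obtain ⟨U, hAU, hUB, hU⟩ := ih (by omega)
    have hlt : U < B := lt_of_le_of_ne hUB (by rintro rfl; omega)
    obtain ⟨v, hvB, hvU⟩ := SetLike.exists_of_lt hlt
    refine ⟨U ⊔ k ∙ v, hAU.trans le_sup_left, sup_le hUB (by simpa using hvB), ?_⟩
    have h0 : v ≠ 0 := by rintro rfl; exact hvU U.zero_mem
    have h1 := Submodule.finrank_sup_add_finrank_inf_eq U (k ∙ v)
    rw [((Submodule.disjoint_span_singleton' h0).2 hvU).eq_bot, finrank_bot,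
      finrank_span_singleton h0, hU] at h1
    omega

theorem exists_finrank_eq_comparable {C : ℕ → Submodule k V} (hC : Antitone C) {c : ℕ}
    (hc : c ≤ finrank k (C 0)) :
    ∃ U ≤ C 0, finrank k U = c ∧ ∀ p, U ≤ C p ∨ C p ≤ U := by
  classical
  by_cases h : ∃ p, finrank k (C p) ≤ c
  · cases hn : Nat.find h with
    | zero =>
      have := Nat.find_spec h
      rw [hn] at this
      exact ⟨C 0, le_rfl, by omega, fun p => Or.inr (hC (Nat.zero_le p))⟩
    | succ n =>
      have h1 := Nat.find_spec h
      have h2 := Nat.find_min h (show n < Nat.find h by omega)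
      rw [hn] at h1
      obtain ⟨U, hU1, hU2, hU⟩ := exists_finrank_eq_between (hC n.le_succ) h1
        (show c ≤ finrank k (C n) by omega)
      refine ⟨U, hU2.trans (hC (Nat.zero_le n)), hU, fun p => ?_⟩
      rcases le_or_gt p n with hp | hp
      · exact Or.inl (hU2.trans (hC hp))
      · exact Or.inr ((hC hp).trans hU1)
  · push Not at h
    obtain ⟨p0, hp0⟩ : ∃ p0, ∀ p, finrank k (C p0) ≤ finrank k (C p) :=
      ⟨Function.argmin fun p => finrank k (C p), fun p =>
        Function.argmin_le (fun p => finrank k (C p)) p⟩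
    obtain ⟨U, -, hU2, hU⟩ := exists_finrank_eq_between (bot_le : ⊥ ≤ C p0) (c := c)
      (by simp) (h p0).le
    refine ⟨U, hU2.trans (hC (Nat.zero_le _)), hU, fun p => Or.inl ?_⟩
    rcases le_total p p0 with hp | hp
    · exact hU2.trans (hC hp)
    · rw [Submodule.eq_of_le_of_finrank_le (hC hp) (hp0 p)]
      exact hU2

theorem finrank_ker_pow_mapQ (g : End k V) (U : Submodule k V) (h : U ≤ U.comap g) (p : ℕ) :
    finrank k (LinearMap.ker (U.mapQ U g h ^ p)) + finrank k U =
      finrank k (U.comap (g ^ p)) := by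
  have hp : U ≤ U.comap (g ^ p) := U.le_comap_pow_of_le_comap h p
  have e : U.mapQ U g h ^ p = U.mapQ U (g ^ p) hp := (U.mapQ_pow h p hp).symm
  rw [e]
  have h1 := finrank_comap_eq U.mkQ (LinearMap.ker (U.mapQ U (g ^ p) hp))
  have h2 : (LinearMap.ker (U.mapQ U (g ^ p) hp)).comap U.mkQ = U.comap (g ^ p) := by
    ext x; simp
  rw [h2, U.range_mkQ, inf_top_eq, U.ker_mkQ] at h1
  omega

theorem le_finrank_ker_pow_mapQ_of_disjoint (g : End k V) (U : Submodule k V)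
    (h : U ≤ U.comap g) (hd : ∀ p, Disjoint (LinearMap.ker (g ^ p)) U) (p : ℕ) :
    finrank k (LinearMap.ker (g ^ p)) ≤ finrank k (LinearMap.ker (U.mapQ U g h ^ p)) := by
  have h1 := finrank_ker_pow_mapQ g U h p
  have h2 := Submodule.finrank_sup_add_finrank_inf_eq (LinearMap.ker (g ^ p)) U
  rw [(hd p).eq_bot, finrank_bot] at h2
  have h3 : LinearMap.ker (g ^ p) ⊔ U ≤ U.comap (g ^ p) := by
    refine sup_le (fun x hx => ?_) (fun x hx => ?_)
    · have hx' : (g ^ p) x = 0 := hx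
      simp [hx']
    · exact U.le_comap_pow_of_le_comap h p hx
  have := Submodule.finrank_mono h3
  omega

/-- Passing to the quotient by a subspace `U` of `ker g` that is comparable with all the
subspaces `ker g ⊓ range (g ^ p)`. -/
theorem finrank_ker_pow_mapQ_of_comparable (g : End k V) (U : Submodule k V)
    (h : U ≤ U.comap g) (hU : U ≤ LinearMap.ker g)
    (hc : ∀ p, U ≤ LinearMap.ker g ⊓ LinearMap.range (g ^ p) ∨
      LinearMap.ker g ⊓ LinearMap.range (g ^ p) ≤ U) (p : ℕ) :
    (finrank k (LinearMap.ker (U.mapQ U g h ^ p)) + finrank k U =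
      finrank k (LinearMap.ker (g ^ (p + 1)))) ∨
    (p * finrank k U ≤ finrank k (LinearMap.ker (U.mapQ U g h ^ p))) := by
  have h1 := finrank_ker_pow_mapQ g U h p
  rw [finrank_comap_eq] at h1
  rcases hc p with hp | hp
  · right
    have e : U ⊓ LinearMap.range (g ^ p) = U := inf_eq_left.2 (hp.trans inf_le_right)
    rw [e] at h1
    have h2 : finrank k U ≤ kerIncr g p := Submodule.finrank_mono hp
    have h3 : p * kerIncr g p ≤ finrank k (LinearMap.ker (g ^ p)) := by
      rw [finrank_ker_pow]
      simpa using Finset.card_nsmul_le_sum (Finset.range p) (kerIncr g) (kerIncr g p)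
        fun q hq => kerIncr_antitone g (by simp at hq; omega)
    have h4 : p * finrank k U ≤ p * kerIncr g p := Nat.mul_le_mul_left p h2
    omega
  · left
    have e : U ⊓ LinearMap.range (g ^ p) = LinearMap.ker g ⊓ LinearMap.range (g ^ p) :=
      le_antisymm (inf_le_inf_right _ hU) (le_inf hp inf_le_right)
    rw [e] at h1
    rw [finrank_ker_pow_succ, kerIncr, h1]

end Flags
section FlagExistence

open Module

section

variable {V : Type*} [AddCommGroup V] [Module k V]

theorem pow_apply_of_eq_smul {f : End k V} {x : V} {a : k} (h : f x = a • x) (q : ℕ) :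
    (f ^ q) x = a ^ q • x := by
  induction q with
  | zero => simp
  | succ q ih => rw [pow_succ', End.mul_apply, ih, map_smul, h, smul_smul, pow_succ]

theorem disjoint_ker_pow_of_eq_smul {f : End k V} {U : Submodule k V} {a lam : k}
    (hU : ∀ v ∈ U, f v = a • v) (h : a ≠ lam) (q : ℕ) :
    Disjoint (LinearMap.ker ((f - lam • (1 : End k V)) ^ q)) U := by
  rw [Submodule.disjoint_def]
  intro x hx hxU
  have h1 : (f - lam • (1 : End k V)) x = (a - lam) • x := by
    rw [LinearMap.sub_apply, hU x hxU, LinearMap.smul_apply, End.one_apply, ← sub_smul]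
  have hx' : ((f - lam • (1 : End k V)) ^ q) x = 0 := hx
  rw [pow_apply_of_eq_smul h1, smul_eq_zero] at hx'
  exact hx'.resolve_left (pow_ne_zero _ (sub_ne_zero.2 h))

theorem mapQ_sub_smul_one (f : End k V) (U : Submodule k V) (hf : U ≤ U.comap f) (lam : k)
    (h : U ≤ U.comap (f - lam • (1 : End k V))) :
    U.mapQ U (f - lam • (1 : End k V)) h = U.mapQ U f hf - lam • (1 : End k (V ⧸ U)) := by
  ext x; simp

end

open Classical in
/-- Existence of a flag with prescribed dimension jumps `c j` on whose successive quotients `f`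
acts by the scalars `ν j`. -/
theorem exists_flag (K : ℕ) : ∀ {V : Type*} [AddCommGroup V] [Module k V] [FiniteDimensional k V]
    (f : End k V) (ν : ℕ → k) (c : ℕ → ℕ), (∀ i j, i ≤ j → j < K → ν i = ν j → c j ≤ c i) →
    (∀ lam : k, ∀ p ≤ K, ∑ j ∈ Finset.range p, (if ν j = lam then c j else 0) ≤
      finrank k (LinearMap.ker ((f - lam • (1 : End k V)) ^
        ∑ j ∈ Finset.range p, if ν j = lam then 1 else 0))) →
    ∃ F : ℕ → Submodule k V, F 0 = ⊥ ∧ (∀ j < K, F j ≤ F (j + 1)) ∧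
      (∀ j ≤ K, finrank k (F j) = ∑ i ∈ Finset.range j, c i) ∧
      ∀ j < K, ∀ v ∈ F (j + 1), f v - ν j • v ∈ F j := by
  induction K with
  | zero =>
    intro V _ _ _ f ν c _ _
    refine ⟨fun _ => ⊥, rfl, fun j hj => by omega, fun j hj => ?_, fun j hj => by omega⟩
    obtain rfl : j = 0 := by omega
    simp
  | succ K ih =>
    intro V _ _ _ f ν c hmono hker
    set g := f - ν 0 • (1 : End k V) with hg
    have hc0 : c 0 ≤ finrank k ↥(LinearMap.ker g ⊓ LinearMap.range (g ^ 0)) := by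
      have := hker (ν 0) 1 (by omega)
      rw [Finset.sum_range_one, Finset.sum_range_one, if_pos rfl, if_pos rfl, pow_one] at this
      rwa [pow_zero, End.one_eq_id, LinearMap.range_id, inf_top_eq]
    obtain ⟨U, hU0, hU, hcomp⟩ := exists_finrank_eq_comparable
      (C := fun p => LinearMap.ker g ⊓ LinearMap.range (g ^ p))
      (fun p q h => inf_le_inf_left _ (range_pow_antitone g h)) hc0
    have hUg : U ≤ LinearMap.ker g := hU0.trans inf_le_left
    have hUf : ∀ v ∈ U, f v = ν 0 • v := fun v hv => by
      have : g v = 0 := hUg hv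
      simpa [hg, sub_eq_zero] using this
    have hf : U ≤ U.comap f := fun v hv => by
      rw [Submodule.mem_comap, hUf v hv]
      exact U.smul_mem _ hv
    have hfl : ∀ lam : k, U ≤ U.comap (f - lam • (1 : End k V)) := fun lam v hv => by
      rw [Submodule.mem_comap]
      simpa using U.sub_mem (hf hv) (U.smul_mem lam hv)
    obtain ⟨F, hF0, hFm, hFd, hFf⟩ := ih (U.mapQ U f hf) (fun j => ν (j + 1)) (fun j => c (j + 1))
      (fun i j hij hj h => hmono _ _ (by omega) (by omega) h) (fun lam p hp => by
        have h := hker lam (p + 1) (by omega)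
        rw [Finset.sum_range_succ', Finset.sum_range_succ'] at h
        rw [← mapQ_sub_smul_one f U hf lam (hfl lam)]
        by_cases hlam : ν 0 = lam
        · subst hlam
          rw [if_pos rfl, if_pos rfl] at h
          rcases finrank_ker_pow_mapQ_of_comparable g U (hfl _) hUg hcomp
            (∑ j ∈ Finset.range p, if ν (j + 1) = ν 0 then 1 else 0) with h' | h'
          · have h2 := h.trans_eq h'.symm
            rw [hU] at h2
            exact Nat.le_of_add_le_add_right h2
          · refine le_trans ?_ h'
            rw [hU, Finset.sum_mul]
            refine Finset.sum_le_sum fun j hj => ?_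
            split_ifs with hj'
            · rw [one_mul]
              exact hmono 0 (j + 1) (by omega) (by simp at hj; omega) hj'.symm
            · simp
        · rw [if_neg hlam, if_neg hlam, add_zero, add_zero] at h
          exact h.trans (le_finrank_ker_pow_mapQ_of_disjoint (f - lam • (1 : End k V)) U (hfl lam)
            (fun q => disjoint_ker_pow_of_eq_smul hUf hlam q) _))
    refine ⟨fun j => Nat.casesOn j ⊥ fun i => (F i).comap U.mkQ, rfl, ?_, ?_, ?_⟩
    · intro j hj
      cases j with
      | zero => exact bot_le
      | succ j => exact Submodule.comap_mono (hFm j (by omega))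
    · intro j hj
      cases j with
      | zero => simp
      | succ j =>
        change finrank k ((F j).comap U.mkQ) = _
        rw [finrank_comap_eq, U.ker_mkQ, U.range_mkQ, inf_top_eq, hFd j (by omega),
          Finset.sum_range_succ', hU, add_comm]
    · intro j hj v hv
      cases j with
      | zero =>
        change v ∈ (F 0).comap U.mkQ at hv
        change f v - ν 0 • v ∈ (⊥ : Submodule k V)
        rw [hF0, ← LinearMap.ker, U.ker_mkQ] at hv
        rw [hUf v hv, sub_self]
        exact Submodule.zero_mem _
      | succ j =>
        have := hFf j (by omega) (U.mkQ v) hv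
        change f v - ν (j + 1) • v ∈ (F j).comap U.mkQ
        simpa using this

end FlagExistence

section FlagTransport

open Module

variable {V : Type*} [AddCommGroup V] [Module k V] [FiniteDimensional k V]

theorem exists_linearEquiv_extend {U U' X X' : Submodule k V} (hX : U ≤ X) (hX' : U' ≤ X')
    (e : V ≃ₗ[k] V) (he : U.map e.toLinearMap = U') (hd : finrank k X = finrank k X') :
    ∃ e' : V ≃ₗ[k] V, (∀ u ∈ U, e' u = e u) ∧ X.map e'.toLinearMap = X' := by
  let a : X ≃ₗ[k] X' := LinearEquiv.ofFinrankEq _ _ hd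
  have hinv : ∀ u : U, e u ∈ X' := fun u => hX' (he ▸ Submodule.mem_map_of_mem u.2)
  let φ : U →ₗ[k] X' := (e.toLinearMap.comp U.subtype).codRestrict X' hinv
  let ψ : U →ₗ[k] X' := a.toLinearMap.comp (Submodule.inclusion hX)
  have hφ : Function.Injective φ := fun x y h => by
    have : e x = e y := congrArg Subtype.val h
    exact Subtype.ext (e.injective this)
  have hψ : Function.Injective ψ := a.injective.comp (Submodule.inclusion_injective hX)
  obtain ⟨g, hg⟩ := Submodule.exists_linearEquiv_restrict_eq
    ((LinearEquiv.ofInjective ψ hψ).symm.trans (LinearEquiv.ofInjective φ hφ))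
  obtain ⟨e', he'⟩ := Submodule.exists_linearEquiv_restrict_eq (a.trans g)
  refine ⟨e', fun u hu => ?_, ?_⟩
  · have h1 := he' ⟨u, hX hu⟩
    have h2 := hg (LinearEquiv.ofInjective ψ hψ ⟨u, hu⟩)
    simp only [LinearEquiv.trans_apply, LinearEquiv.symm_apply_apply] at h1 h2
    rw [← h1]
    exact congrArg Subtype.val h2.symm
  · refine Submodule.eq_of_le_of_finrank_eq ?_ ?_
    · rintro _ ⟨x, hx, rfl⟩
      have h1 := he' ⟨x, hx⟩
      change e' x ∈ X'
      rw [← h1]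
      exact ((a.trans g) ⟨x, hx⟩).2
    · rw [LinearEquiv.finrank_map_eq, hd]

theorem exists_linearEquiv_map_flag (F F' : ℕ → Submodule k V) (K : ℕ)
    (hF : ∀ j < K, F j ≤ F (j + 1)) (hF' : ∀ j < K, F' j ≤ F' (j + 1))
    (hd : ∀ j ≤ K, finrank k (F j) = finrank k (F' j)) :
    ∃ e : V ≃ₗ[k] V, ∀ j ≤ K, (F j).map e.toLinearMap = F' j := by
  induction K with
  | zero =>
    obtain ⟨e, -, he⟩ := exists_linearEquiv_extend (U := ⊥) (U' := ⊥) bot_le bot_le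
      (LinearEquiv.refl k V) (Submodule.map_bot _) (hd 0 le_rfl)
    exact ⟨e, fun j hj => by obtain rfl : j = 0 := by omega
                             exact he⟩
  | succ K ih =>
    obtain ⟨e, he⟩ := ih (fun j hj => hF j (by omega)) (fun j hj => hF' j (by omega))
      fun j hj => hd j (by omega)
    obtain ⟨e', he1, he2⟩ := exists_linearEquiv_extend (hF K (by omega)) (hF' K (by omega)) e
      (he K le_rfl) (hd (K + 1) le_rfl)
    have hle : ∀ j ≤ K, F j ≤ F K := fun j hj => by
      induction K, hj using Nat.le_induction with
      | base => exact le_rfl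
      | succ K hjK ihK =>
        exact le_trans (by
          refine Nat.le_induction (m := j) (P := fun n _ => n ≤ K → F j ≤ F n)
            (fun _ => le_rfl) (fun n _ hn hnK => (hn (by omega)).trans (hF n (by omega))) K hjK
            le_rfl) (hF K (by omega))
    refine ⟨e', fun j hj => ?_⟩
    rcases Nat.lt_or_eq_of_le hj with h | rfl
    · rw [← he j (by omega)]
      ext x
      constructor
      · rintro ⟨y, hy, rfl⟩
        exact ⟨y, hy, (he1 y (hle j (by omega) hy)).symm⟩
      · rintro ⟨y, hy, rfl⟩
        exact ⟨y, hy, he1 y (hle j (by omega) hy)⟩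
    · exact he2

end FlagTransport

section FlagPerturbation

open Module Polynomial

variable {V : Type*} [AddCommGroup V] [Module k V]

/-- The iterated kernels of a product of shifts of `M`. -/
def shiftFlag (M : End k V) (μ : ℕ → k) : ℕ → Submodule k V
  | 0 => ⊥
  | j + 1 => (shiftFlag M μ j).comap (M - μ j • (1 : End k V))

theorem mem_shiftFlag_succ {M : End k V} {μ : ℕ → k} {j : ℕ} {v : V} :
    v ∈ shiftFlag M μ (j + 1) ↔ M v - μ j • v ∈ shiftFlag M μ j := Iff.rfl

theorem shiftFlag_eq_ker (M : End k V) (μ : ℕ → k) (j : ℕ) :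
    shiftFlag M μ j = LinearMap.ker (aeval M (∏ i ∈ Finset.range j, (X - C (μ i)))) := by
  induction j with
  | zero => simp [shiftFlag, End.one_eq_id]
  | succ j ih =>
    ext v
    rw [mem_shiftFlag_succ, ih, Finset.prod_range_succ, map_mul, LinearMap.mem_ker,
      LinearMap.mem_ker, End.mul_apply]
    simp [Algebra.algebraMap_eq_smul_one]

theorem shiftFlag_map_of_commute {M : End k V} {μ : ℕ → k} {Z : End k V} (h : M * Z = Z * M)
    (j : ℕ) : ∀ v ∈ shiftFlag M μ j, Z v ∈ shiftFlag M μ j := by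
  induction j with
  | zero => intro v hv; rw [(Submodule.mem_bot k).1 hv, map_zero]; exact Submodule.zero_mem _
  | succ j ih =>
    intro v hv
    rw [mem_shiftFlag_succ] at hv ⊢
    have h1 : M (Z v) = Z (M v) := LinearMap.congr_fun h v
    rw [h1, ← map_smul, ← map_sub]
    exact ih _ hv

theorem shiftFlag_le_succ (M : End k V) (μ : ℕ → k) (j : ℕ) :
    shiftFlag M μ j ≤ shiftFlag M μ (j + 1) := fun v hv =>
  Submodule.sub_mem _ (shiftFlag_map_of_commute rfl j v hv) (Submodule.smul_mem _ _ hv)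

theorem shiftFlag_map_of_commutator {M : End k V} {μ : ℕ → k} {K : ℕ} {S Y : End k V}
    (h : M * S - S * M = Y)
    (hY : ∀ j < K, ∀ v ∈ shiftFlag M μ (j + 1), Y v ∈ shiftFlag M μ j)
    (j : ℕ) (hj : j ≤ K) : ∀ v ∈ shiftFlag M μ j, S v ∈ shiftFlag M μ j := by
  induction j with
  | zero => intro v hv; rw [(Submodule.mem_bot k).1 hv, map_zero]; exact Submodule.zero_mem _
  | succ j ih =>
    intro v hv
    have h1 : M (S v) = Y v + S (M v) := by
      rw [← h]; simp
    have h2 : M (S v) - μ j • S v = Y v + S (M v - μ j • v) := by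
      rw [h1, map_sub, map_smul, add_sub_assoc]
    rw [mem_shiftFlag_succ, h2]
    exact Submodule.add_mem _ (hY j (by omega) v hv) (ih (by omega) _ hv)

theorem isNilpotent_of_map_succ_le {F : ℕ → Submodule k V} {K : ℕ} (h0 : F 0 = ⊥) (hK : F K = ⊤)
    {Y : End k V} (hY : ∀ j < K, ∀ v ∈ F (j + 1), Y v ∈ F j) : IsNilpotent Y := by
  have h : ∀ j ≤ K, ∀ v ∈ F j, (Y ^ j) v = 0 := by
    intro j
    induction j with
    | zero => intro _ v hv; rw [h0, Submodule.mem_bot] at hv; rw [hv, map_zero]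
    | succ j ih =>
      intro hj v hv
      rw [pow_succ, End.mul_apply]
      exact ih (by omega) _ (hY j (by omega) v hv)
  exact ⟨K, LinearMap.ext fun v => h K le_rfl v (hK ▸ Submodule.mem_top)⟩

variable [FiniteDimensional k V]

theorem exists_trace_mul_eq (φ : End k V →ₗ[k] k) :
    ∃ Z : End k V, ∀ W : End k V, φ W = LinearMap.trace k V (W * Z) := by
  let τ : End k V →ₗ[k] Dual k (End k V) :=
    LinearMap.mk₂ k (fun Z W => LinearMap.trace k V (W * Z))
      (fun a b c => by rw [mul_add, map_add])
      (fun a b c => by rw [mul_smul_comm, map_smul])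
      (fun a b c => by rw [add_mul, map_add])
      (fun a b c => by rw [smul_mul_assoc, map_smul])
  have hinj : Function.Injective τ := by
    rw [injective_iff_map_eq_zero]
    intro Z hZ
    ext v
    refine (forall_dual_apply_eq_zero_iff k (Z v)).1 fun f => ?_
    have h := LinearMap.congr_fun hZ (f.smulRight v)
    have h' : LinearMap.trace k V ((f.comp Z).smulRight v) = 0 := h
    rwa [LinearMap.trace_smulRight] at h'
  obtain ⟨Z, hZ⟩ := (LinearMap.injective_iff_surjective_of_finrank_eq_finrank
    Subspace.dual_finrank_eq.symm).1 hinj φ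
  exact ⟨Z, fun W => (LinearMap.congr_fun hZ W).symm⟩

/-- Endomorphisms shifting a flag strictly. -/
def strictStab (F : ℕ → Submodule k V) (K : ℕ) : Submodule k (End k V) where
  carrier := {Y | ∀ j < K, ∀ v ∈ F (j + 1), Y v ∈ F j}
  add_mem' := fun ha hb j hj v hv => Submodule.add_mem _ (ha j hj v hv) (hb j hj v hv)
  zero_mem' := fun _ _ _ _ => Submodule.zero_mem _
  smul_mem' := fun c _ ha j hj v hv => Submodule.smul_mem _ c (ha j hj v hv)

/-- The commutator with `M`. -/
def commutatorMap (M : End k V) : End k V →ₗ[k] End k V :=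
  LinearMap.mulLeft k M - LinearMap.mulRight k M

theorem strictStab_le_range_commutator {M : End k V} {μ : ℕ → k} {K : ℕ}
    (hK : shiftFlag M μ K = ⊤) :
    strictStab (shiftFlag M μ) K ≤ LinearMap.range (commutatorMap M) := by
  intro Y hY
  by_contra hYn
  obtain ⟨φ, hφY, hφ⟩ := Submodule.exists_le_ker_of_notMem hYn
  obtain ⟨Z, hZ⟩ := exists_trace_mul_eq φ
  have hcomm : Z * M - M * Z = 0 := by
    have key : ∀ W : End k V, LinearMap.trace k V (W * (Z * M - M * Z)) = 0 := fun W => by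
      have h1 : φ (M * W - W * M) = 0 := hφ ⟨W, rfl⟩
      rw [hZ, sub_mul, map_sub, mul_assoc M W Z, LinearMap.trace_mul_comm k M (W * Z)] at h1
      rw [mul_sub, map_sub, ← mul_assoc, ← mul_assoc]
      exact h1
    ext v
    refine (forall_dual_apply_eq_zero_iff k _).1 fun f => ?_
    have h2 := key (f.smulRight v)
    have h3 : f.smulRight v * (Z * M - M * Z) = (f.comp (Z * M - M * Z)).smulRight v := rfl
    rwa [h3, LinearMap.trace_smulRight] at h2
  apply hφY
  rw [hZ]
  refine IsNilpotent.eq_zero (LinearMap.isNilpotent_trace_of_isNilpotent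
    (isNilpotent_of_map_succ_le (F := shiftFlag M μ) rfl hK fun j hj v hv => ?_))
  exact hY j hj _ (shiftFlag_map_of_commute (sub_eq_zero.1 hcomm).symm (j + 1) v hv)

theorem exists_polynomial_det {ι : Type*} [Fintype ι] (T : ι → End k V) (q : k[X])
    (p : ι → k[X]) :
    ∃ f : k[X], ∀ u : k, f.eval u =
      LinearMap.det (q.eval u • (1 : End k V) + ∑ i, (p i).eval u • T i) := by
  classical
  let b := finBasis k V
  refine ⟨(q • (1 : Matrix _ _ k[X]) +
    ∑ i, p i • (LinearMap.toMatrix b b (T i)).map C).det, fun u => ?_⟩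
  rw [← LinearMap.det_toMatrix b, ← coe_evalRingHom, RingHom.map_det]
  congr 1
  ext i j
  simp [Matrix.sum_apply, Matrix.add_apply, Matrix.one_apply, eval_finsetSum, apply_ite (eval u),
    LinearMap.toMatrix_one]

theorem exists_polynomial_solve {W : Type*} [AddCommGroup W] [Module k W] [FiniteDimensional k W]
    (G : End k W) (D : W) :
    ∃ (d : k[X]) (y : Fin (finrank k W) → k[X]), d.eval 0 = 1 ∧
      (∀ i, (y i).eval 0 = 0) ∧ ∀ u : k,
      (∑ i, (y i).eval u • finBasis k W i) + u • G (∑ i, (y i).eval u • finBasis k W i) =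
        (d.eval u * u) • D := by
  classical
  let b := finBasis k W
  let Gm := LinearMap.toMatrix b b G
  let A : Matrix _ _ k[X] := 1 + (X : k[X]) • Gm.map C
  have hA : ∀ u, A.map (eval u) = 1 + u • Gm := fun u => by
    ext i j
    simp [A, Matrix.one_apply, apply_ite (eval u)]
    exact mul_comm _ _
  let v : Fin (finrank k W) → k[X] := fun i => X * C (b.repr D i)
  refine ⟨A.det, A.adjugate.mulVec v, ?_, fun i => ?_, fun u => ?_⟩
  · rw [← coe_evalRingHom, RingHom.map_det]
    change (A.map (eval 0)).det = 1
    rw [hA]; simp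
  · rw [← coe_evalRingHom, RingHom.map_mulVec]
    have : (⇑(evalRingHom (0 : k)) ∘ v) = 0 := by ext i; simp [v]
    rw [this]; simp
  · set y := A.adjugate.mulVec v with hy
    have h1 : A.mulVec y = A.det • v := by
      rw [hy, Matrix.mulVec_mulVec, Matrix.mul_adjugate, Matrix.smul_mulVec, Matrix.one_mulVec]
    have h2 : (1 + u • Gm).mulVec (fun i => (y i).eval u) = (A.det.eval u * u) • ⇑(b.repr D) := by
      ext i
      have h3 := congrArg (evalRingHom u) (congrFun h1 i)
      rw [RingHom.map_mulVec] at h3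
      change (A.map (eval u)).mulVec _ i = _ at h3
      rw [hA] at h3
      refine Eq.trans h3 ?_
      simp [v, mul_assoc, mul_comm u]
    set w : W := ∑ i, (y i).eval u • b i with hw
    have hrepr : ⇑(b.repr w) = fun i => (y i).eval u := by
      ext i
      rw [hw, Basis.repr_sum_self]
    apply b.repr.injective
    apply DFunLike.coe_injective
    rw [map_add, map_smul, map_smul, Finsupp.coe_add, Finsupp.coe_smul, Finsupp.coe_smul, ← h2,
      ← LinearMap.toMatrix_mulVec_repr b b G w, hrepr, Matrix.add_mulVec, Matrix.one_mulVec,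
      Matrix.smul_mulVec]

/-- A strictly flag-lowering perturbation of `M` is generically conjugate to `M`. -/
theorem exists_polynomial_conj {M D : End k V} {μ : ℕ → k} {K : ℕ}
    (hK : shiftFlag M μ K = ⊤)
    (hD : ∀ j < K, ∀ v ∈ shiftFlag M μ (j + 1), D v ∈ shiftFlag M μ j) :
    ∃ f : k[X], f ≠ 0 ∧ ∀ u : k, f.eval u ≠ 0 →
      ∃ P : V ≃ₗ[k] V, ∀ v, (M + u • D) (P v) = P (M v) := by
  let N := strictStab (shiftFlag M μ) K
  let p : N.comap (commutatorMap M) →ₗ[k] N := (commutatorMap M).restrict fun _ h => h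
  obtain ⟨S', hS'⟩ := p.exists_rightInverse_of_surjective (by
    rw [LinearMap.range_eq_top]
    rintro ⟨Y, hY⟩
    obtain ⟨Z, hZ⟩ := strictStab_le_range_commutator hK hY
    exact ⟨⟨Z, by rw [Submodule.mem_comap, hZ]; exact hY⟩, Subtype.ext hZ⟩)
  let S : N →ₗ[k] End k V := (Submodule.subtype _).comp S'
  have hS : ∀ Y : N, M * S Y - S Y * M = Y := fun Y =>
    congrArg Subtype.val (LinearMap.congr_fun hS' Y)
  let G : End k N := ((LinearMap.mulLeft k D).comp S).codRestrict N fun Y j hj v hv =>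
    hD j hj _ (shiftFlag_map_of_commutator (hS Y) Y.2 (j + 1) hj v hv)
  obtain ⟨d, y, hd0, hy0, hy⟩ := exists_polynomial_solve G ⟨D, hD⟩
  obtain ⟨f, hf⟩ := exists_polynomial_det (fun i => -S (finBasis k N i)) d y
  refine ⟨f, fun h => ?_, fun u hu => ?_⟩
  · have := hf 0
    simp [h, hd0, hy0] at this
  · set Y : N := ∑ i, (y i).eval u • finBasis k N i with hYdef
    set Q : End k V := d.eval u • (1 : End k V) - S Y with hQ
    have hQ' : f.eval u = LinearMap.det Q := by
      rw [hf, hQ, hYdef, map_sum, sub_eq_add_neg, ← Finset.sum_neg_distrib]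
      simp only [map_smul, smul_neg]
    have h1 : (Y : End k V) + u • (D * S Y) = (d.eval u * u) • D :=
      congrArg Subtype.val (hy u)
    have h2 : (M + u • D) * Q = Q * M := by
      have h3 := hS Y
      have h4 : (d.eval u * u) • D = d.eval u • u • D := smul_smul _ _ _ |>.symm
      rw [h4, ← h3] at h1
      rw [hQ, mul_sub, sub_mul, mul_smul_comm, mul_one, smul_mul_assoc, one_mul, smul_add, ← h1,
        add_mul, smul_mul_assoc]
      abel
    refine ⟨LinearEquiv.ofIsUnitDet (f := Q) (v := finBasis k V) (v' := finBasis k V) ?_,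
      fun v => LinearMap.congr_fun h2 v⟩
    rw [LinearMap.det_toMatrix, ← hQ']
    exact hu.isUnit

end FlagPerturbation

section SpectralData

open Module Polynomial

variable {V : Type*} [AddCommGroup V] [Module k V]
variable {ι : Type*}

/-- `f` has Jordan type `a i` at the eigenvalue `lam i`, and there are no other eigenvalues. -/
structure IsSpectralData [Fintype ι] (f : End k V) (lam : ι → k) (a : ι → ℕ → ℕ) : Prop where
  inj : Function.Injective lam
  anti : ∀ i, Antitone (a i)
  zero : ∀ i t, finrank k V ≤ t → a i t = 0
  finrank_ker : ∀ i p, finrank k (LinearMap.ker ((f - lam i • (1 : End k V)) ^ p)) =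
    ∑ t ∈ Finset.range (finrank k V), min (a i t) p
  total : ∑ i, ∑ t ∈ Finset.range (finrank k V), a i t = finrank k V

theorem ker_aeval_sub_C_pow (f : End k V) (c : k) (n : ℕ) :
    LinearMap.ker (aeval f ((X - C c) ^ n)) =
      LinearMap.ker ((f - c • (1 : End k V)) ^ n) := by
  simp [Algebra.algebraMap_eq_smul_one]

/-- The number of parts greater than `j`, i.e. the parts of the conjugate partition. -/
def conjPart (N : ℕ) (A : ℕ → ℕ) (j : ℕ) : ℕ := ((Finset.range N).filter fun t => j < A t).card

theorem conjPart_antitone (N : ℕ) (A : ℕ → ℕ) : Antitone (conjPart N A) := fun _ _ h =>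
  Finset.card_le_card fun t ht => by
    rw [Finset.mem_filter] at ht ⊢
    exact ⟨ht.1, lt_of_le_of_lt h ht.2⟩

theorem sum_min_succ (N : ℕ) (A : ℕ → ℕ) (p : ℕ) :
    ∑ t ∈ Finset.range N, min (A t) (p + 1) =
      ∑ t ∈ Finset.range N, min (A t) p + conjPart N A p := by
  rw [conjPart, Finset.card_filter, ← Finset.sum_add_distrib]
  exact Finset.sum_congr rfl fun t _ => by split_ifs <;> omega

theorem sum_range_conjPart (N : ℕ) (A : ℕ → ℕ) (p : ℕ) :
    ∑ j ∈ Finset.range p, conjPart N A j = ∑ t ∈ Finset.range N, min (A t) p := by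
  induction p with
  | zero => simp
  | succ p ih => rw [Finset.sum_range_succ, ih, sum_min_succ]

/-- The number of occurrences of `i` among the first `p` letters of `w`. -/
def letterCount [DecidableEq ι] (w : ℕ → ι) (i : ι) (p : ℕ) : ℕ :=
  ((Finset.range p).filter fun j => w j = i).card

theorem letterCount_succ [DecidableEq ι] (w : ℕ → ι) (i : ι) (p : ℕ) :
    letterCount w i (p + 1) = letterCount w i p + if w p = i then 1 else 0 := by
  simp only [letterCount, Finset.card_filter, Finset.sum_range_succ]

variable [Fintype ι]

theorem sum_ite_conjPart [DecidableEq ι] {a : ι → ℕ → ℕ} {w : ℕ → ι}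
    (hw : ∀ t p, ∑ i, min (a i t) (letterCount w i p) = min (∑ i, a i t) p) (N : ℕ) (i : ι)
    (p : ℕ) :
    ∑ j ∈ Finset.range p, (if w j = i then conjPart N (fun t => ∑ i, a i t) j else 0) =
      ∑ t ∈ Finset.range N, min (a i t) (letterCount w i p) := by
  induction p with
  | zero => simp [letterCount]
  | succ p ih =>
    rw [Finset.sum_range_succ, ih, letterCount_succ]
    split_ifs with h
    · rw [conjPart, Finset.card_filter, ← Finset.sum_add_distrib]
      refine Finset.sum_congr rfl fun t _ => ?_
      have h1 := hw t p
      have h2 := hw t (p + 1)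
      rw [← Finset.add_sum_erase _ _ (Finset.mem_univ i)] at h1 h2
      have h3 : ∑ x ∈ Finset.univ.erase i, min (a x t) (letterCount w x (p + 1)) =
          ∑ x ∈ Finset.univ.erase i, min (a x t) (letterCount w x p) :=
        Finset.sum_congr rfl fun x hx => by
          rw [letterCount_succ, if_neg (fun hwx => Finset.ne_of_mem_erase hx (hwx.symm.trans h)),
            add_zero]
      rw [h3, letterCount_succ, if_pos h] at h2
      split_ifs <;> omega
    · simp

namespace IsSpectralData

variable {f : End k V} {lam : ι → k} {a : ι → ℕ → ℕ}

theorem le_finrank (h : IsSpectralData f lam a) (t : ℕ) : ∑ i, a i t ≤ finrank k V := by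
  rcases lt_or_ge t (finrank k V) with ht | ht
  · calc ∑ i, a i t ≤ ∑ i, ∑ t ∈ Finset.range (finrank k V), a i t :=
        Finset.sum_le_sum fun i _ =>
          Finset.single_le_sum (f := a i) (fun _ _ => Nat.zero_le _) (Finset.mem_range.2 ht)
      _ = _ := h.total
  · simp [h.zero _ t ht]

theorem sum_total (h : IsSpectralData f lam a) :
    ∑ t ∈ Finset.range (finrank k V), ∑ i, a i t = finrank k V := by
  rw [Finset.sum_comm, h.total]

theorem exists_word [DecidableEq ι] (h : IsSpectralData f lam a) (hV : 0 < finrank k V) :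
    ∃ w : ℕ → ι, ∀ t p, ∑ i, min (a i t) (letterCount w i p) = min (∑ i, a i t) p := by
  have : Nonempty ι := by
    by_contra hι
    rw [not_nonempty_iff] at hι
    have := h.total
    simp at this
    omega
  obtain ⟨w, hw⟩ := exists_path (finrank k V) (fun t i => a i t)
    (fun s t hst i => h.anti i hst) (funext fun i => h.zero i _ le_rfl)
  exact ⟨w, hw⟩

end IsSpectralData

variable [FiniteDimensional k V]

theorem finrank_ker_aeval_prod_sub_C_pow (f : End k V) {lam : ι → k}
    (hlam : Function.Injective lam) (n : ι → ℕ) :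
    finrank k (LinearMap.ker (aeval f (∏ i, (X - C (lam i)) ^ n i))) =
      ∑ i, finrank k (LinearMap.ker ((f - lam i • (1 : End k V)) ^ n i)) := by
  rw [finrank_ker_aeval_prod f Finset.univ _ fun i _ j _ hij =>
    ((pairwise_coprime_X_sub_C hlam) hij).pow]
  exact Finset.sum_congr rfl fun i _ => by rw [ker_aeval_sub_C_pow]

theorem prod_range_sub_C [DecidableEq ι] (lam : ι → k) (w : ℕ → ι) (p : ℕ) :
    ∏ j ∈ Finset.range p, (X - C (lam (w j))) = ∏ i, (X - C (lam i)) ^ letterCount w i p := by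
  rw [← Finset.prod_fiberwise (Finset.range p) w]
  refine Finset.prod_congr rfl fun i _ => ?_
  rw [letterCount, ← Finset.prod_const]
  exact Finset.prod_congr rfl fun j hj => by rw [(Finset.mem_filter.1 hj).2]

theorem finrank_shiftFlag [DecidableEq ι] (f : End k V) {lam : ι → k} (hlam : Function.Injective lam)
    (w : ℕ → ι) (p : ℕ) :
    finrank k (shiftFlag f (fun j => lam (w j)) p) =
      ∑ i, finrank k (LinearMap.ker ((f - lam i • (1 : End k V)) ^ letterCount w i p)) := by
  rw [shiftFlag_eq_ker, prod_range_sub_C, finrank_ker_aeval_prod_sub_C_pow f hlam]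

namespace IsSpectralData

variable {f : End k V} {lam : ι → k} {a : ι → ℕ → ℕ}

theorem finrank_shiftFlag_eq [DecidableEq ι] (h : IsSpectralData f lam a) {w : ℕ → ι}
    (hw : ∀ t p, ∑ i, min (a i t) (letterCount w i p) = min (∑ i, a i t) p) (p : ℕ) :
    finrank k (shiftFlag f (fun j => lam (w j)) p) =
      ∑ t ∈ Finset.range (finrank k V), min (∑ i, a i t) p := by
  rw [finrank_shiftFlag f h.inj]
  simp only [h.finrank_ker]
  rw [Finset.sum_comm]
  exact Finset.sum_congr rfl fun t _ => hw t p

theorem shiftFlag_finrank_eq_top [DecidableEq ι] (h : IsSpectralData f lam a) {w : ℕ → ι}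
    (hw : ∀ t p, ∑ i, min (a i t) (letterCount w i p) = min (∑ i, a i t) p) :
    shiftFlag f (fun j => lam (w j)) (finrank k V) = ⊤ := by
  apply Submodule.eq_top_of_finrank_eq
  rw [h.finrank_shiftFlag_eq hw]
  exact (Finset.sum_congr rfl fun t _ => min_eq_left (h.le_finrank t)).trans h.sum_total

end IsSpectralData

/-- A matching flag for `g` exhibits `g` as a limit of generic conjugates of `f`. -/
theorem exists_generic_conj_of_flag {f g : End k V} {μ : ℕ → k} {α : k} {K : ℕ} {c : ℕ → ℕ}
    (hK : shiftFlag f μ K = ⊤) (hc : Antitone c)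
    (hd : ∀ p, finrank k (shiftFlag f μ p) = ∑ j ∈ Finset.range p, c j)
    (hker : open Classical in ∀ x : k, ∀ p ≤ K,
      ∑ j ∈ Finset.range p, (if α * μ j = x then c j else 0) ≤
      finrank k (LinearMap.ker ((g - x • (1 : End k V)) ^
        ∑ j ∈ Finset.range p, if α * μ j = x then 1 else 0))) :
    ∃ f' D : End k V, g = α • f' + D ∧
      {u : k | ¬ ∃ P : V ≃ₗ[k] V, ∀ v, (f' + u • D) (P v) = P (f v)}.Finite := by
  obtain ⟨G, hG0, hGm, hGd, hGg⟩ := exists_flag K g (fun j => α * μ j) c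
    (fun i j hij _ _ => hc hij) hker
  obtain ⟨e, he⟩ := exists_linearEquiv_map_flag (shiftFlag f μ) G K
    (fun j _ => shiftFlag_le_succ f μ j) hGm fun j hj => by rw [hd, hGd j hj]
  let g' : End k V := e.symm.conj g
  have hD : ∀ j < K, ∀ v ∈ shiftFlag f μ (j + 1), (g' - α • f) v ∈ shiftFlag f μ j := by
    intro j hj v hv
    have h1 : g (e v) - (α * μ j) • e v ∈ G j :=
      hGg j hj _ (by rw [← he (j + 1) hj]; exact ⟨v, hv, rfl⟩)
    rw [← he j hj.le] at h1
    obtain ⟨x, hx, hxe⟩ := h1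
    have h2 : x = g' v - (α * μ j) • v := by
      apply e.injective
      refine Eq.trans hxe ?_
      simp [g', LinearEquiv.conj_apply]
    have h3 : (g' - α • f) v = x - α • (f v - μ j • v) := by
      rw [h2, smul_sub, smul_smul, LinearMap.sub_apply, LinearMap.smul_apply]
      abel
    rw [h3]
    exact Submodule.sub_mem _ hx (Submodule.smul_mem _ _ hv)
  obtain ⟨q, hq, hP⟩ := exists_polynomial_conj hK hD
  classical
  refine ⟨e.conj f, e.conj (g' - α • f), ?_, ?_⟩
  · ext v
    simp [g', LinearEquiv.conj_apply]
  · refine Set.Finite.subset (q.roots.toFinset.finite_toSet) fun u hu => ?_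
    by_contra hroot
    have hqu : q.eval u ≠ 0 := fun h0 => hroot (by simpa [hq] using h0)
    obtain ⟨P, hPu⟩ := hP u hqu
    refine hu ⟨P.trans e, fun v => ?_⟩
    have := congrArg e (hPu v)
    simpa [LinearEquiv.conj_apply] using this

variable {f g : End k V} {lam : ι → k} {a : ι → ℕ → ℕ}

theorem IsSpectralData.exists_generic_conj [DecidableEq ι] {b : ι → ℕ → ℕ} {α : k} (hα : α ≠ 0)
    (hf : IsSpectralData f lam a) (hg : IsSpectralData g (fun i => α * lam i) b)
    (hab : ∀ i, ∑ t ∈ Finset.range (finrank k V), a i t = ∑ t ∈ Finset.range (finrank k V), b i t)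
    (hdom : ∀ i m, ∑ t ∈ Finset.range m, b i t ≤ ∑ t ∈ Finset.range m, a i t)
    (hV : 0 < finrank k V) :
    ∃ f' D : End k V, g = α • f' + D ∧
      {u : k | ¬ ∃ P : V ≃ₗ[k] V, ∀ v, (f' + u • D) (P v) = P (f v)}.Finite := by
  obtain ⟨w, hw⟩ := hf.exists_word hV
  refine exists_generic_conj_of_flag (hf.shiftFlag_finrank_eq_top hw)
    (conjPart_antitone (finrank k V) fun t => ∑ i, a i t)
    (fun p => by rw [hf.finrank_shiftFlag_eq hw, sum_range_conjPart]) fun x p _ => ?_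
  by_cases hx : ∃ i, α * lam i = x
  · obtain ⟨i, rfl⟩ := hx
    have hiff : ∀ j, α * lam (w j) = α * lam i ↔ w j = i := fun j =>
      ⟨fun h => hf.inj (mul_left_cancel₀ hα h), fun h => by rw [h]⟩
    simp only [hiff]
    have h1 := sum_ite_conjPart hw (finrank k V) i p
    have h2 := sum_min_le_of_dominates (hg.anti i) (hg.zero i) (hab i) (hdom i)
      (letterCount w i p)
    rw [← hg.finrank_ker i] at h2
    rw [letterCount, Finset.card_filter] at h1 h2
    convert h1.trans_le h2 <;> exact hiff _
  · have hne : ∀ j, ¬ α * lam (w j) = x := fun j h => hx ⟨_, h⟩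
    simp [hne]

theorem IsSpectralData.exists_generic_conj_zero [DecidableEq ι] {b : ℕ → ℕ}
    (hf : IsSpectralData f lam a) (hb : Antitone b) (hb0 : ∀ t, finrank k V ≤ t → b t = 0)
    (hbN : ∑ t ∈ Finset.range (finrank k V), b t = finrank k V)
    (hg : ∀ p, finrank k (LinearMap.ker (g ^ p)) =
      ∑ t ∈ Finset.range (finrank k V), min (b t) p)
    (hdom : ∀ m, ∑ t ∈ Finset.range m, b t ≤ ∑ t ∈ Finset.range m, ∑ i, a i t)
    (hV : 0 < finrank k V) :
    ∃ f' : End k V,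
      {u : k | ¬ ∃ P : V ≃ₗ[k] V, ∀ v, (f' + u • g) (P v) = P (f v)}.Finite := by
  obtain ⟨w, hw⟩ := hf.exists_word hV
  obtain ⟨f', D, hD, h⟩ := exists_generic_conj_of_flag (g := g) (α := 0)
    (hf.shiftFlag_finrank_eq_top hw)
    (conjPart_antitone (finrank k V) fun t => ∑ i, a i t)
    (fun p => by rw [hf.finrank_shiftFlag_eq hw, sum_range_conjPart]) fun x p _ => by
      by_cases hx : x = 0
      · subst hx
        have h2 := sum_min_le_of_dominates hb hb0 (hf.sum_total.trans hbN.symm) hdom p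
        rw [← sum_range_conjPart, ← hg] at h2
        convert h2 <;> simp
      · simp [Ne.symm hx]
  rw [zero_smul, zero_add] at hD
  exact ⟨f', hD ▸ h⟩

end SpectralData

section JordanType

open Module Polynomial

variable {V : Type*} [AddCommGroup V] [Module k V] [FiniteDimensional k V]
variable {ι : Type*} [Fintype ι]

theorem sum_eq_finrank_ker_pow {f : End k V} {b : ℕ → ℕ}
    (h : ∀ p, finrank k (LinearMap.ker (f ^ p)) =
      ∑ t ∈ Finset.range (finrank k V), min (b t) p) :
    ∑ t ∈ Finset.range (finrank k V), b t = finrank k (LinearMap.ker (f ^ finrank k V)) := by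
  set P := ∑ t ∈ Finset.range (finrank k V), b t with hP
  have hbP : ∀ t ∈ Finset.range (finrank k V), b t ≤ P := fun t ht =>
    Finset.single_le_sum (f := b) (fun _ _ => Nat.zero_le _) ht
  have h1 : P = finrank k (LinearMap.ker (f ^ P)) := by
    rw [h]
    exact Finset.sum_congr rfl fun t ht => (min_eq_left (hbP t ht)).symm
  have h2 : P ≤ finrank k V := h1.trans_le (Submodule.finrank_le _)
  rw [h]
  exact Finset.sum_congr rfl fun t ht => (min_eq_left ((hbP t ht).trans h2)).symm

theorem finrank_ker_aeval_prod_of_eigenvalues [IsAlgClosed k] {f : End k V} {lam : ι → k}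
    (h : ∀ c, f.HasEigenvalue c → ∃ i, lam i = c) :
    LinearMap.ker (aeval f (∏ i, (X - C (lam i)) ^ finrank k V)) = ⊤ := by
  classical
  rw [eq_top_iff, ← End.iSup_maxGenEigenspace_eq_top f, iSup_le_iff]
  intro c
  rw [End.maxGenEigenspace_eq_genEigenspace_finrank]
  by_cases hc : f.genEigenspace c (finrank k V) = ⊥
  · rw [hc]; exact bot_le
  · obtain ⟨i, rfl⟩ := h c (End.hasEigenvalue_of_hasGenEigenvalue (k := finrank k V) hc)
    rw [End.genEigenspace_nat, ← ker_aeval_sub_C_pow, ← Finset.prod_erase_mul _ _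
      (Finset.mem_univ i), map_mul]
    exact LinearMap.ker_le_ker_comp _ _

namespace IsSpectralData

variable {f : End k V} {lam : ι → k} {a : ι → ℕ → ℕ}

theorem of_eigenvalues [IsAlgClosed k] (hlam : Function.Injective lam) (ha : ∀ i, Antitone (a i))
    (ha0 : ∀ i t, finrank k V ≤ t → a i t = 0)
    (hker : ∀ i p, finrank k (LinearMap.ker ((f - lam i • (1 : End k V)) ^ p)) =
      ∑ t ∈ Finset.range (finrank k V), min (a i t) p)
    (h : ∀ c, f.HasEigenvalue c → ∃ i, lam i = c) : IsSpectralData f lam a := by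
  refine ⟨hlam, ha, ha0, hker, ?_⟩
  have h1 := finrank_ker_aeval_prod_sub_C_pow f hlam fun _ => finrank k V
  rw [finrank_ker_aeval_prod_of_eigenvalues h, finrank_top] at h1
  exact (Finset.sum_congr rfl fun i _ => sum_eq_finrank_ker_pow (hker i)).trans h1.symm

theorem exists_eq_of_apply_eq_smul (h : IsSpectralData f lam a) {c : k} {v : V} (hv : v ≠ 0)
    (hc : f v = c • v) : ∃ i, lam i = c := by
  have h1 := finrank_ker_aeval_prod_sub_C_pow f h.inj fun _ => finrank k V
  rw [← (Finset.sum_congr rfl fun i _ => sum_eq_finrank_ker_pow (h.finrank_ker i)), h.total] at h1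
  have h2 : aeval f (∏ i, (X - C (lam i)) ^ finrank k V) v = 0 := by
    rw [← LinearMap.mem_ker, Submodule.eq_top_of_finrank_eq h1]
    exact Submodule.mem_top
  rw [End.aeval_apply_of_hasEigenvector (End.hasEigenvector_iff.2
    ⟨End.mem_eigenspace_iff.2 hc, hv⟩)] at h2
  have h3 := (smul_eq_zero.1 h2).resolve_right hv
  rw [eval_prod, Finset.prod_eq_zero_iff] at h3
  obtain ⟨i, -, hi⟩ := h3
  refine ⟨i, ?_⟩
  rw [eval_pow] at hi
  have h4 := eq_zero_of_pow_eq_zero hi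
  rw [eval_sub, eval_X, eval_C, sub_eq_zero] at h4
  exact h4.symm

theorem exists_dominated {g : End k V} (h : IsSpectralData f lam a) {c : k} (hc : c ≠ 0)
    (hfg : ∀ i p, finrank k (LinearMap.ker ((f - lam i • (1 : End k V)) ^ p)) ≤
      finrank k (LinearMap.ker ((g - (c * lam i) • (1 : End k V)) ^ p))) :
    ∃ b : ι → ℕ → ℕ, IsSpectralData g (fun i => c * lam i) b ∧
      (∀ i, ∑ t ∈ Finset.range (finrank k V), b i t = ∑ t ∈ Finset.range (finrank k V), a i t) ∧
      ∀ i m, ∑ t ∈ Finset.range m, b i t ≤ ∑ t ∈ Finset.range m, a i t := by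
  choose b hb hb0 hbker using fun i => exists_jordan_partition (g - (c * lam i) • (1 : End k V))
  have hinj : Function.Injective fun i => c * lam i := fun i j hij =>
    h.inj (mul_left_cancel₀ hc hij)
  have hle : ∀ i, ∑ t ∈ Finset.range (finrank k V), a i t ≤
      ∑ t ∈ Finset.range (finrank k V), b i t := fun i => by
    rw [sum_eq_finrank_ker_pow (h.finrank_ker i), sum_eq_finrank_ker_pow (hbker i)]
    exact hfg i _
  have htot : ∑ i, ∑ t ∈ Finset.range (finrank k V), b i t ≤ finrank k V := by
    rw [Finset.sum_congr rfl fun i _ => sum_eq_finrank_ker_pow (hbker i),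
      ← finrank_ker_aeval_prod_sub_C_pow g hinj fun _ => finrank k V]
    exact Submodule.finrank_le _
  have heq : ∀ i, ∑ t ∈ Finset.range (finrank k V), a i t =
      ∑ t ∈ Finset.range (finrank k V), b i t := fun i =>
    (Finset.sum_eq_sum_iff_of_le fun i _ => hle i).1
      (le_antisymm (Finset.sum_le_sum fun i _ => hle i) (htot.trans_eq h.total.symm)) i
      (Finset.mem_univ i)
  refine ⟨b, ⟨hinj, hb, hb0, hbker, ?_⟩, fun i => (heq i).symm, fun i m => ?_⟩
  · exact (Finset.sum_congr rfl fun i _ => (heq i).symm).trans h.total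
  · refine dominates_of_sum_min_le (h.anti i) (h.zero i) (hb0 i) (heq i) (fun p => ?_) m
    rw [← h.finrank_ker, ← hbker]
    exact hfg i p

theorem exists_dominated_zero [DecidableEq ι] {g : End k V} (h : IsSpectralData f lam a)
    (hV : 0 < finrank k V)
    (hfg : ∀ (w : ℕ → ι) p, finrank k (shiftFlag f (fun j => lam (w j)) p) ≤
      finrank k (LinearMap.ker (g ^ p))) :
    ∃ b : ℕ → ℕ, Antitone b ∧ (∀ t, finrank k V ≤ t → b t = 0) ∧
      (∀ p, finrank k (LinearMap.ker (g ^ p)) =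
        ∑ t ∈ Finset.range (finrank k V), min (b t) p) ∧
      (∑ t ∈ Finset.range (finrank k V), b t = finrank k V) ∧
      ∀ m, ∑ t ∈ Finset.range m, b t ≤ ∑ t ∈ Finset.range m, ∑ i, a i t := by
  obtain ⟨w, hw⟩ := h.exists_word hV
  obtain ⟨b, hb, hb0, hbker⟩ := exists_jordan_partition g
  have hsum : ∑ t ∈ Finset.range (finrank k V), b t = finrank k V := by
    rw [sum_eq_finrank_ker_pow hbker]
    refine le_antisymm (Submodule.finrank_le _) ?_
    have := hfg w (finrank k V)
    rwa [h.shiftFlag_finrank_eq_top hw, finrank_top] at this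
  refine ⟨b, hb, hb0, hbker, hsum, dominates_of_sum_min_le
    (fun s t hst => Finset.sum_le_sum fun i _ => h.anti i hst)
    (fun t ht => Finset.sum_eq_zero fun i _ => h.zero i t ht) hb0
    (h.sum_total.trans hsum.symm) fun p => ?_⟩
  rw [← hbker, ← h.finrank_shiftFlag_eq hw]
  exact hfg w p

end IsSpectralData

theorem IsPartitionOf.antitone {a : ℕ → ℕ} {N : ℕ} (h : IsPartitionOf a N) : Antitone a := h.1

theorem IsPartitionOf.eq_zero {a : ℕ → ℕ} {N m : ℕ} (h : IsPartitionOf a N) (hN : N ≤ m) {t : ℕ}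
    (ht : m ≤ t) : a t = 0 := by
  obtain ⟨ha, l, hl, hs⟩ := h
  by_contra h0
  have htl : t < l := lt_of_not_ge fun hlt => h0 (hl t hlt)
  have h1 : ∑ i ∈ Finset.range (t + 1), 1 ≤ ∑ i ∈ Finset.range (t + 1), a i :=
    Finset.sum_le_sum fun i hi => by
      have := ha i t (by simpa [Nat.lt_succ_iff] using hi)
      omega
  have h2 : ∑ i ∈ Finset.range (t + 1), a i ≤ ∑ i ∈ Finset.range l, a i :=
    Finset.sum_le_sum_of_subset (Finset.range_mono htl)
  simp at h1
  omega

theorem sum_range_eq_of_eq_zero {a : ℕ → ℕ} {l m : ℕ} (hl : ∀ i, l ≤ i → a i = 0)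
    (hm : ∀ i, m ≤ i → a i = 0) : ∑ i ∈ Finset.range l, a i = ∑ i ∈ Finset.range m, a i := by
  rcases le_total l m with h | h
  · exact Finset.sum_subset (Finset.range_mono h) fun i _ hi => hl i (by simpa using hi)
  · exact (Finset.sum_subset (Finset.range_mono h) fun i _ hi => hm i (by simpa using hi)).symm

theorem IsPartitionOf.sum_range {a : ℕ → ℕ} {N m : ℕ} (h : IsPartitionOf a N)
    (hm : ∀ t, m ≤ t → a t = 0) : ∑ t ∈ Finset.range m, a t = N := by
  obtain ⟨-, l, hl, hs⟩ := h
  rw [← hs, sum_range_eq_of_eq_zero hm hl]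

variable {m : ℕ}

theorem toLinAlgEquiv_sub_smul_pow (M : Matrix (Fin m) (Fin m) k) (c : k) (p : ℕ) :
    Matrix.toLinAlgEquiv' ((M - c • (1 : Matrix (Fin m) (Fin m) k)) ^ p) =
      (Matrix.toLinAlgEquiv' M - c • (1 : End k (Fin m → k))) ^ p := by
  rw [map_pow, map_sub, map_smul, map_one]

theorem rank_add_finrank_ker (M : Matrix (Fin m) (Fin m) k) :
    M.rank + finrank k (LinearMap.ker (Matrix.toLinAlgEquiv' M)) = m := by
  have := LinearMap.finrank_range_add_finrank_ker M.mulVecLin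
  rwa [finrank_fin_fun] at this

theorem rank_sub_smul_pow_add_finrank_ker (M : Matrix (Fin m) (Fin m) k) (c : k) (p : ℕ) :
    ((M - c • (1 : Matrix (Fin m) (Fin m) k)) ^ p).rank + finrank k (LinearMap.ker
      ((Matrix.toLinAlgEquiv' M - c • (1 : End k (Fin m → k))) ^ p)) = m := by
  rw [← toLinAlgEquiv_sub_smul_pow, rank_add_finrank_ker]

theorem IsJordanTypeAt.finrank_ker {M : Matrix (Fin m) (Fin m) k} {c : k} {a : ℕ → ℕ}
    (h : IsJordanTypeAt M c a) (p : ℕ) :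
    finrank k (LinearMap.ker ((Matrix.toLinAlgEquiv' M - c • (1 : End k (Fin m → k))) ^ p)) =
      ∑ t ∈ Finset.range m, min (a t) p := by
  have h1 := rank_sub_smul_pow_add_finrank_ker M c p
  have h2 := h.2 p
  have h3 : ∑ t ∈ Finset.range m, min (a t) p ≤ m := by
    calc ∑ t ∈ Finset.range m, min (a t) p ≤ ∑ t ∈ Finset.range m, a t :=
          Finset.sum_le_sum fun t _ => min_le_left _ _
      _ = _ := h.1.sum_range fun t ht => h.1.eq_zero (Nat.sub_le _ _) ht
      _ ≤ m := Nat.sub_le _ _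
  omega

theorem IsJordanTypeAt.of_finrank_ker {M : Matrix (Fin m) (Fin m) k} {c : k} {b : ℕ → ℕ}
    (hb : Antitone b) (hb0 : ∀ t, m ≤ t → b t = 0)
    (h : ∀ p, finrank k (LinearMap.ker
      ((Matrix.toLinAlgEquiv' M - c • (1 : End k (Fin m → k))) ^ p)) =
      ∑ t ∈ Finset.range m, min (b t) p) : IsJordanTypeAt M c b := by
  refine ⟨⟨fun i j hij => hb hij, m, hb0, ?_⟩, fun p => ?_⟩
  · have h1 := rank_sub_smul_pow_add_finrank_ker M c m
    have h2 := sum_eq_finrank_ker_pow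
      (f := Matrix.toLinAlgEquiv' M - c • (1 : End k (Fin m → k))) (b := b)
      (by rwa [finrank_fin_fun])
    rw [finrank_fin_fun] at h2
    omega
  · have h1 := rank_sub_smul_pow_add_finrank_ker M c p
    have h2 := h p
    omega

theorem IsFullSpecter.isSpectralData [IsAlgClosed k] {M : Matrix (Fin m) (Fin m) k} {l : ℕ}
    {lam : Fin l → k} {a : Fin l → ℕ → ℕ} (h : IsFullSpecter M lam a) :
    IsSpectralData (Matrix.toLinAlgEquiv' M) lam a := by
  refine IsSpectralData.of_eigenvalues h.1 (fun i => (h.2.1 i).1.1.antitone) (fun i t ht => ?_)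
    (fun i p => ?_) fun c hc => ?_
  · rw [finrank_fin_fun] at ht
    exact (h.2.1 i).1.1.eq_zero (Nat.sub_le _ _) ht
  · rw [finrank_fin_fun]
    exact (h.2.1 i).1.finrank_ker p
  · obtain ⟨v, hv⟩ := hc.exists_hasEigenvector
    exact h.2.2 c ⟨v, hv.2, hv.apply_eq_smul⟩

theorem IsSpectralData.isFullSpecter {M : Matrix (Fin m) (Fin m) k} {l : ℕ}
    {lam : Fin l → k} {b : Fin l → ℕ → ℕ} (h : IsSpectralData (Matrix.toLinAlgEquiv' M) lam b)
    (hb : ∀ i, b i 0 ≠ 0) : IsFullSpecter M lam b := by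
  refine ⟨h.inj, fun i => ⟨IsJordanTypeAt.of_finrank_ker (h.anti i) (fun t ht => h.zero i t ?_)
    fun p => ?_, hb i⟩, fun c ⟨v, hv, hc⟩ => h.exists_eq_of_apply_eq_smul hv hc⟩
  · rwa [finrank_fin_fun]
  · rw [h.finrank_ker, finrank_fin_fun]

end JordanType

section AlgebraStructures

open Matrix

theorem ofConst_apply {n : ℕ} (c : Fin n → Fin n → Fin n → k) (x y : Fin n → k) (p : Fin n) :
    ofConst c x y p = ∑ i, ∑ j, x i * y j * c i j p := by
  simp [ofConst, LinearMap.sum_apply, Finset.sum_apply]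

theorem Tstr_apply {m : ℕ} (α : k) (M : Matrix (Fin m) (Fin m) k) (x y : Fin (m + 1) → k) :
    Tstr α M x y = (α * y 0) • x + x 0 • (Fin.cons 0 (M *ᵥ Fin.tail y) : Fin (m + 1) → k) -
      y 0 • (Fin.cons 0 (M *ᵥ Fin.tail x) : Fin (m + 1) → k) := by
  funext p
  refine Fin.cases ?_ (fun p => ?_) p
  · simp [Tstr, ofConst_apply]
    ring
  · simp [Tstr, ofConst_apply, Fin.sum_univ_succ, mulVec, dotProduct, Fin.tail, mul_sub,
      Finset.sum_sub_distrib, Finset.mul_sum]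
    have h₁ : ∀ j, x 0 * y (Fin.succ j) * M p j = x 0 * (M p j * y (Fin.succ j)) := fun j => by ring
    have h₂ : ∀ j, x (Fin.succ j) * y 0 * M p j = y 0 * (M p j * x (Fin.succ j)) := fun j => by ring
    simp only [h₁, h₂]
    ring

theorem Tstr_add_smul {m : ℕ} (α β t : k) (M N : Matrix (Fin m) (Fin m) k) :
    Tstr (α + t * β) (M + t • N) = Tstr α M + t • Tstr β N := by
  refine LinearMap.ext fun x => LinearMap.ext fun y => funext fun p => ?_
  refine Fin.cases ?_ (fun p => ?_) p <;>
  · simp [Tstr_apply, add_mulVec, smul_mulVec]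
    ring

theorem transport_eq_iff {n : ℕ} (g : (Fin n → k) ≃ₗ[k] (Fin n → k)) (μ χ : AlgStr k n) :
    transport g μ = χ ↔ ∀ x y, g (μ x y) = χ (g x) (g y) := by
  refine ⟨?_, fun h => LinearMap.ext fun x => LinearMap.ext fun y => ?_⟩
  · rintro rfl x y
    simp [transport]
  · simp [transport, h]

theorem Tstr_smul_mem_orbit {m : ℕ} {c : k} (hc : c ≠ 0) (α : k) {M A : Matrix (Fin m) (Fin m) k}
    (P : (Fin m → k) ≃ₗ[k] (Fin m → k)) (hP : ∀ v, A *ᵥ P v = P (M *ᵥ v)) :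
    Tstr (c * α) (c • A) ∈ orbit (Tstr α M) := by
  let g : (Fin (m + 1) → k) ≃ₗ[k] (Fin (m + 1) → k) :=
    (Fin.consLinearEquiv k fun _ => k).symm ≪≫ₗ
      ((LinearEquiv.smulOfNeZero k k c⁻¹ (inv_ne_zero hc)).prodCongr P) ≪≫ₗ
      Fin.consLinearEquiv k fun _ => k
  have hg₀ : ∀ x, g x 0 = c⁻¹ * x 0 := fun x => by simp [g]
  have hg : ∀ x, Fin.tail (g x) = P (Fin.tail x) := fun x => by simp [g]; rfl
  have hgs : ∀ x p, g x (Fin.succ p) = P (Fin.tail x) p := fun x p => by rw [← hg]; rfl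
  refine ⟨g, (transport_eq_iff _ _ _).2 fun x y => ?_⟩
  have ht : Fin.tail (Tstr α M x y) = (α * y 0) • Fin.tail x + x 0 • (M *ᵥ Fin.tail y) -
      y 0 • (M *ᵥ Fin.tail x) := by
    funext p
    simp [Tstr_apply, Fin.tail]
  funext p
  refine Fin.cases ?_ (fun p => ?_) p
  · simp [Tstr_apply, hg₀]
    field_simp
  · rw [hgs, ht]
    simp [Tstr_apply, hg, hgs, hg₀, smul_mulVec, hP]
    field_simp

theorem add_smul_mem_zclosure [Infinite k] {n : ℕ} {S : Set (AlgStr k n)} {μ ν : AlgStr k n}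
    (h : {t : k | μ + t • ν ∉ S}.Finite) (t : k) : μ + t • ν ∈ zclosure S := by
  rintro T ⟨P, hT⟩ hST
  refine (hT _).2 fun p hp => ?_
  let q : Polynomial k := MvPolynomial.aeval
    (fun i => Polynomial.C (structConst μ i) + Polynomial.X * Polynomial.C (structConst ν i)) p
  have hq : ∀ u : k, q.eval u = MvPolynomial.eval (structConst (μ + u • ν)) p := fun u => by
    have : (Polynomial.aeval u : Polynomial k →ₐ[k] k).comp (MvPolynomial.aeval
        (fun i => Polynomial.C (structConst μ i) + Polynomial.X * Polynomial.C (structConst ν i))) =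
        MvPolynomial.aeval (structConst (μ + u • ν)) := by
      ext i
      simp [structConst]
      ring
    have h' := DFunLike.congr_fun this p
    simpa [q, Polynomial.aeval_def, MvPolynomial.aeval_eq_eval] using h'
  have hz : q = 0 := by
    refine Polynomial.eq_zero_of_infinite_isRoot q (h.infinite_compl.mono fun u hu => ?_)
    have hu' : μ + u • ν ∈ S := by simpa using hu
    exact (hq u).trans ((hT _).1 (hST hu') p hp)
  rw [← hq, hz, Polynomial.eval_zero]

end AlgebraStructures

section Sufficiency

open Module Matrix

variable {m l : ℕ} {M L : Matrix (Fin m) (Fin m) k} {lam : Fin l → k} {a : Fin l → ℕ → ℕ}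

theorem IsSpectralData.sum_range {M : Matrix (Fin m) (Fin m) k}
    (h : IsSpectralData (Matrix.toLinAlgEquiv' M) lam a) {i : Fin l} {N : ℕ}
    (hN : IsPartitionOf (a i) N) :
    ∑ t ∈ Finset.range (finrank k (Fin m → k)), a i t = N :=
  hN.sum_range (h.zero i)

theorem degenerates_Tstr_smul [Infinite k] (hm : 1 ≤ m) (r : k) {α : k} (hα : α ≠ 0)
    {b : Fin l → ℕ → ℕ} {κ : Fin l → ℕ}
    (hM : IsSpectralData (Matrix.toLinAlgEquiv' M) lam a)
    (hL : IsSpectralData (Matrix.toLinAlgEquiv' L) (fun i => α * lam i) b)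
    (ha : ∀ i, IsPartitionOf (a i) (κ i)) (hb : ∀ i, IsPartitionOf (b i) (κ i))
    (hdom : ∀ i, Dominates (a i) (b i)) :
    degenerates (Tstr r M) (Tstr (α * r) L) := by
  obtain ⟨f', D, hg, hfin⟩ := hM.exists_generic_conj hα hL
    (fun i => (hM.sum_range (ha i)).trans (hL.sum_range (hb i)).symm) hdom
    (by rw [finrank_fin_fun]; exact hm)
  obtain ⟨F, rfl⟩ := (Matrix.toLinAlgEquiv' (R := k) (n := Fin m)).surjective f'
  obtain ⟨D, rfl⟩ := (Matrix.toLinAlgEquiv' (R := k) (n := Fin m)).surjective D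
  have hg' : L = α • F + D := Matrix.toLinAlgEquiv'.injective (by simpa using hg)
  have hcurve : ∀ t : k, Tstr (α * r) (α • F) + t • Tstr 0 D =
      Tstr (α * r) (α • (F + (α⁻¹ * t) • D)) := fun t => by
    rw [← Tstr_add_smul, mul_zero, add_zero, smul_add, smul_smul, mul_inv_cancel_left₀ hα]
  have h1 := add_smul_mem_zclosure (S := orbit (Tstr r M)) (μ := Tstr (α * r) (α • F))
    (ν := Tstr 0 D) (?_) 1
  · rw [hcurve, mul_one, smul_add, smul_smul, mul_inv_cancel₀ hα, one_smul, ← hg'] at h1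
    exact h1
  · refine (hfin.preimage (f := fun t => α⁻¹ * t)
      (mul_right_injective₀ (inv_ne_zero hα)).injOn).subset fun t ht => ?_
    rintro ⟨P, hP⟩
    refine ht ?_
    rw [hcurve]
    refine Tstr_smul_mem_orbit hα r P fun v => ?_
    simpa [Matrix.toLinAlgEquiv'_apply, add_mulVec, smul_mulVec] using hP v

theorem degenerates_Tstr_zero [Infinite k] (hm : 1 ≤ m) (r : k) {b : ℕ → ℕ}
    (hM : IsSpectralData (Matrix.toLinAlgEquiv' M) lam a)
    (hL : IsJordanTypeAt L 0 b) (hb : IsPartitionOf b m)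
    (hdom : Dominates (fun t => ∑ i, a i t) b) :
    degenerates (Tstr r M) (Tstr 0 L) := by
  have hb0 : ∀ t, m ≤ t → b t = 0 := fun t ht => hb.eq_zero le_rfl ht
  obtain ⟨f', hfin⟩ := hM.exists_generic_conj_zero (g := Matrix.toLinAlgEquiv' L) hb.antitone
    (by rw [finrank_fin_fun]; exact hb0) (by rw [finrank_fin_fun]; exact hb.sum_range hb0)
    (fun p => by
      have h := hL.finrank_ker p
      rw [zero_smul, sub_zero] at h
      rw [h, finrank_fin_fun]) hdom
    (by rw [finrank_fin_fun]; exact hm)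
  obtain ⟨F, rfl⟩ := (Matrix.toLinAlgEquiv' (R := k) (n := Fin m)).surjective f'
  have h1 := add_smul_mem_zclosure (S := orbit (Tstr r M)) (μ := Tstr 0 L) (ν := Tstr r F) (?_) 0
  · rw [zero_smul, add_zero] at h1
    exact h1
  · refine ((hfin.preimage (f := fun t => t⁻¹) inv_injective.injOn).insert 0).subset
      fun t ht => ?_
    by_cases ht0 : t = 0
    · exact Or.inl ht0
    refine Or.inr ?_
    rintro ⟨P, hP⟩
    refine ht ?_
    have hcurve : Tstr 0 L + t • Tstr r F = Tstr (t * r) (t • (F + t⁻¹ • L)) := by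
      rw [← Tstr_add_smul, zero_add, smul_add, smul_smul, mul_inv_cancel₀ ht0, one_smul, add_comm L]
    rw [hcurve]
    refine Tstr_smul_mem_orbit ht0 r P fun v => ?_
    simpa [Matrix.toLinAlgEquiv'_apply, add_mulVec, smul_mulVec] using hP v

end Sufficiency

section SpecializationLemmas

open Matrix

/-- A point of the Zariski closure of a family of points lifts along a function on the family
that is integral over the coordinates. -/
theorem exists_lift_of_integral [IsAlgClosed k] {σ Z : Type*} (c : Z → σ → k) (x : σ → k)
    (hx : ∀ p : MvPolynomial σ k, (∀ z, MvPolynomial.eval (c z) p = 0) →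
      MvPolynomial.eval x p = 0) (e : Z → k) (q : Polynomial (MvPolynomial σ k)) (hq : q.Monic)
    (he : ∀ z, q.eval₂ (MvPolynomial.eval (c z)) (e z) = 0) :
    ∃ e₀ : k, ∀ p : MvPolynomial (Option σ) k,
      (∀ z, MvPolynomial.eval (fun o => o.elim (e z) (c z)) p = 0) →
        MvPolynomial.eval (fun o => o.elim e₀ x) p = 0 := by
  let ev : (MvPolynomial σ k) →+* (Z → k) := RingHom.pi fun z => MvPolynomial.eval (c z)
  let _ : Algebra (MvPolynomial σ k) (Z → k) := ev.toAlgebra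
  have hev : ∀ s z, algebraMap (MvPolynomial σ k) (Z → k) s z = MvPolynomial.eval (c z) s :=
    fun _ _ => rfl
  have heint : IsIntegral (MvPolynomial σ k) e := ⟨q, hq, funext fun z => by
    have h1 := Polynomial.hom_eval₂ q (algebraMap (MvPolynomial σ k) (Z → k))
      (Pi.evalRingHom (fun _ => k) z) e
    exact h1.trans (he z)⟩
  let B := integralClosure (MvPolynomial σ k) (Z → k)
  let P : Ideal (MvPolynomial σ k) := RingHom.ker (MvPolynomial.eval x)
  have : P.IsMaximal := RingHom.ker_isMaximal_of_surjective _ fun a => ⟨MvPolynomial.C a, by simp⟩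
  obtain ⟨Q, hQm, hQ⟩ := Ideal.exists_ideal_over_maximal_of_isIntegral (S := B) P fun s hs => by
    refine hx s fun z => ?_
    have h1 : (algebraMap (MvPolynomial σ k) B s : Z → k) = 0 := congrArg Subtype.val hs
    exact congrFun h1 z
  let φ : (MvPolynomial σ k) →+* B ⧸ Q := (Ideal.Quotient.mk Q).comp (algebraMap (MvPolynomial σ k) B)
  let f : k →+* B ⧸ Q := φ.comp MvPolynomial.C
  have hφ : ∀ s, φ s = f (MvPolynomial.eval x s) := fun s => by
    have h1 : s - MvPolynomial.C (MvPolynomial.eval x s) ∈ P := by simp [P, RingHom.mem_ker]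
    rw [← hQ, Ideal.mem_comap, ← Ideal.Quotient.eq_zero_iff_mem] at h1
    have h2 : φ (s - MvPolynomial.C (MvPolynomial.eval x s)) = 0 := h1
    rw [map_sub, sub_eq_zero] at h2
    exact h2
  have hf : f.IsIntegral := fun y => by
    obtain ⟨b, rfl⟩ := Ideal.Quotient.mk_surjective y
    obtain ⟨p, hp, hpb⟩ := Algebra.IsIntegral.isIntegral (R := MvPolynomial σ k) b
    refine ⟨p.map (MvPolynomial.eval x), hp.map _, ?_⟩
    have h1 : f.comp (MvPolynomial.eval x) = φ := RingHom.ext fun s => (hφ s).symm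
    rw [Polynomial.eval₂_map, h1, ← Polynomial.hom_eval₂, hpb, map_zero]
  let E := RingEquiv.ofBijective f (IsAlgClosed.ringHom_bijective_of_isIntegral f hf)
  let ψ : B →+* k := E.symm.toRingHom.comp (Ideal.Quotient.mk Q)
  have hψ : ∀ s, ψ (algebraMap (MvPolynomial σ k) B s) = MvPolynomial.eval x s := fun s =>
    E.symm_apply_eq.2 (hφ s)
  let eB : B := ⟨e, heint⟩
  refine ⟨ψ eB, fun p hp => ?_⟩
  let g : MvPolynomial (Option σ) k →+* B := MvPolynomial.eval₂Hom
    ((algebraMap (MvPolynomial σ k) B).comp MvPolynomial.C) fun o =>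
      o.elim eB fun i => algebraMap (MvPolynomial σ k) B (.X i)
  have h1 : ψ.comp g = MvPolynomial.eval (fun o => o.elim (ψ eB) x) := by
    refine MvPolynomial.ringHom_ext (fun a => ?_) fun o => ?_
    · simp [g, hψ]
    · cases o <;> simp [g, hψ]
  have h2 : ∀ z, ((Pi.evalRingHom (fun _ => k) z).comp B.val.toRingHom).comp g =
      MvPolynomial.eval (fun o => o.elim (e z) (c z)) := fun z => by
    have h3 : ∀ s, (algebraMap (MvPolynomial σ k) B s : Z → k) z = MvPolynomial.eval (c z) s :=
      fun s => rfl
    refine MvPolynomial.ringHom_ext (fun a => ?_) fun o => ?_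
    · simp [g, hev]
    · cases o <;> simp [g, h3, eB]
  have h4 : g p = 0 := Subtype.ext (funext fun z => (DFunLike.congr_fun (h2 z) p).trans (hp z))
  rw [← h1, RingHom.comp_apply, h4, map_zero]

theorem exists_mul_mul_eq_one {m : ℕ} (A : Matrix (Fin m) (Fin m) k) :
    ∃ (U : Matrix (Fin A.rank) (Fin m) k) (W : Matrix (Fin m) (Fin A.rank) k), U * A * W = 1 := by
  obtain ⟨V, U, e, -, -, h⟩ := exists_rank_normal_form A
  refine ⟨V.submatrix (fun i => e.symm (Sum.inl i)) id, U.submatrix id fun i => e.symm (Sum.inl i),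
    ?_⟩
  have h1 := congrArg (fun X => X.submatrix (fun i : Fin A.rank => e.symm (Sum.inl i))
    fun i : Fin A.rank => e.symm (Sum.inl i)) h
  have h2 : V.submatrix (fun i => e.symm (Sum.inl i)) id * A *
      U.submatrix id (fun i => e.symm (Sum.inl i)) =
      (V * A * U).submatrix (fun i => e.symm (Sum.inl i)) fun i => e.symm (Sum.inl i) := by
    rw [submatrix_mul _ _ _ id _ Function.bijective_id, submatrix_mul _ _ _ id _
      Function.bijective_id, submatrix_id_id]
  rw [h2]
  refine h1.trans ?_
  ext i j
  simp [one_apply]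

/-- Rank bounds for a polynomial family of matrices pass to the Zariski closure. -/
theorem rank_map_eval_le {σ Z : Type*} (c : Z → σ → k) (x : σ → k)
    (hx : ∀ p : MvPolynomial σ k, (∀ z, MvPolynomial.eval (c z) p = 0) →
      MvPolynomial.eval x p = 0) {m N : ℕ} (A : Matrix (Fin m) (Fin m) (MvPolynomial σ k))
    (hA : ∀ z, (A.map (MvPolynomial.eval (c z))).rank ≤ N) :
    (A.map (MvPolynomial.eval x)).rank ≤ N := by
  by_contra! hlt
  obtain ⟨U, W, hUW⟩ := exists_mul_mul_eq_one (A.map (MvPolynomial.eval x))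
  let U' : Matrix (Fin (A.map (MvPolynomial.eval x)).rank) (Fin m) (MvPolynomial σ k) :=
    U.map MvPolynomial.C
  let W' : Matrix (Fin m) (Fin (A.map (MvPolynomial.eval x)).rank) (MvPolynomial σ k) :=
    W.map MvPolynomial.C
  have hdet : ∀ y : σ → k, MvPolynomial.eval y (U' * A * W').det =
      (U * A.map (MvPolynomial.eval y) * W).det := fun y => by
    rw [RingHom.map_det, RingHom.mapMatrix_apply, Matrix.map_mul, Matrix.map_mul]
    congr 2
    · congr 1
      ext i j; simp [U']
    · ext i j; simp [W']
  have h0 := hx (U' * A * W').det fun z => by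
    rw [hdet]
    by_contra hne
    have h1 := rank_of_isUnit _ ((isUnit_iff_isUnit_det _).2 (isUnit_iff_ne_zero.2 hne))
    have h2 := (rank_mul_le_left (U * A.map (MvPolynomial.eval (c z))) W).trans
      (rank_mul_le_right _ _)
    have h3 := hA z
    rw [Fintype.card_fin] at h1
    omega
  rw [hdet, hUW, det_one] at h0
  exact one_ne_zero h0

end SpecializationLemmas

section Necessity

open Matrix

variable {m : ℕ}

/-- The matrix of left multiplication by the first basis vector on the remaining ones. -/
def leftMulMatrix (μ : AlgStr k (m + 1)) : Matrix (Fin m) (Fin m) k :=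
  of fun i j => structConst μ (0, j.succ, i.succ)

/-- The product of the matrices `M - c • 1` over a list of scalars `c`. -/
def prodSub {R : Type*} [CommRing R] (M : Matrix (Fin m) (Fin m) R) (w : List R) :
    Matrix (Fin m) (Fin m) R :=
  (w.map fun c => M - c • (1 : Matrix (Fin m) (Fin m) R)).prod

theorem prodSub_nil {R : Type*} [CommRing R] (M : Matrix (Fin m) (Fin m) R) :
    prodSub M [] = 1 := rfl

theorem prodSub_cons {R : Type*} [CommRing R] (M : Matrix (Fin m) (Fin m) R) (c : R)
    (w : List R) : prodSub M (c :: w) = (M - c • (1 : Matrix (Fin m) (Fin m) R)) * prodSub M w := by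
  simp [prodSub]

theorem prodSub_map {R S : Type*} [CommRing R] [CommRing S] (f : R →+* S)
    (M : Matrix (Fin m) (Fin m) R) (w : List R) :
    (prodSub M w).map f = prodSub (M.map f) (w.map f) := by
  induction w with
  | nil => simp [prodSub_nil, Matrix.map_one]
  | cons c w ih =>
    rw [prodSub_cons, List.map_cons, prodSub_cons, Matrix.map_mul, ih]
    congr 1
    ext i j
    simp [Matrix.one_apply, apply_ite f]

theorem smul_prodSub_of_mul_eq_smul_one {c : k} {Q Q' M : Matrix (Fin m) (Fin m) k}
    (h : Q * Q' = c • 1) (h' : Q' * Q = c • 1) (w : List k) :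
    c • prodSub (Q * M * Q') (w.map fun x => c * x) = c ^ w.length • (Q * prodSub M w * Q') := by
  induction w with
  | nil => simp [prodSub_nil, h]
  | cons x w ih =>
    have h3 : Q * M * Q' - (c * x) • (1 : Matrix (Fin m) (Fin m) k) = Q * (M - x • 1) * Q' := by
      rw [Matrix.mul_sub, Matrix.sub_mul, Matrix.mul_smul, Matrix.smul_mul, Matrix.mul_one, h,
        smul_smul, mul_comm c x]
    rw [List.map_cons, prodSub_cons, prodSub_cons, ← Matrix.mul_smul, ih, h3, Matrix.mul_smul,
      List.length_cons, pow_succ, mul_smul]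
    congr 1
    calc Q * (M - x • 1) * Q' * (Q * prodSub M w * Q')
        = Q * (M - x • 1) * (Q' * Q) * (prodSub M w * Q') := by simp only [Matrix.mul_assoc]
      _ = c • (Q * ((M - x • 1) * prodSub M w) * Q') := by
          rw [h', Matrix.mul_smul, Matrix.mul_one, Matrix.smul_mul]
          simp only [Matrix.mul_assoc]

theorem rank_prodSub_le_of_mul_eq_smul_one {c : k} {Q Q' M : Matrix (Fin m) (Fin m) k}
    (hc : c ≠ 0) (h : Q * Q' = c • 1) (h' : Q' * Q = c • 1) (w : List k) :
    (prodSub (Q * M * Q') (w.map fun x => c * x)).rank ≤ (prodSub M w).rank := by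
  have h1 : prodSub (Q * M * Q') (w.map fun x => c * x) =
      (c⁻¹ * c ^ w.length) • Q * prodSub M w * Q' := by
    rw [Matrix.smul_mul, Matrix.smul_mul, mul_smul, ← smul_prodSub_of_mul_eq_smul_one h h',
      smul_smul, inv_mul_cancel₀ hc, one_smul]
  rw [h1]
  exact (rank_mul_le_left _ _).trans (rank_mul_le_right _ _)

theorem rank_prodSub_le_of_sq_eq_zero {A M : Matrix (Fin m) (Fin m) k} (hA : A * A = 0)
    (hrk : A.rank ≤ 1) (hM : ∀ x : k, M = x • 1 → A = 0) (w : List k) :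
    (prodSub A (w.map fun x => 0 * x)).rank ≤ (prodSub M w).rank := by
  match w with
  | [] => simp [prodSub_nil]
  | [x] =>
    simp only [List.map_cons, List.map_nil, prodSub_cons, prodSub_nil, zero_mul, zero_smul,
      sub_zero, Matrix.mul_one]
    by_cases h0 : M - x • (1 : Matrix (Fin m) (Fin m) k) = 0
    · rw [hM x (sub_eq_zero.1 h0), rank_zero]
      exact Nat.zero_le _
    · refine hrk.trans (Nat.one_le_iff_ne_zero.2 fun h1 => h0 ?_)
      rw [Matrix.rank, Submodule.finrank_eq_zero, LinearMap.range_eq_bot] at h1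
      exact (LinearEquiv.map_eq_zero_iff Matrix.toLin').1 h1
  | x :: y :: w =>
    simp only [List.map_cons, prodSub_cons, zero_mul, zero_smul, sub_zero, ← Matrix.mul_assoc, hA,
      rank_zero]
    exact Nat.zero_le _

theorem structConst_transport_Tstr_zero (r : k) (M : Matrix (Fin m) (Fin m) k)
    (g : (Fin (m + 1) → k) ≃ₗ[k] (Fin (m + 1) → k)) :
    structConst (transport g (Tstr r M)) (0, 0, 0) = r * g.symm (Pi.single 0 1) 0 := by
  simp [structConst, transport, Tstr_apply, mul_comm]

theorem exists_leftMulMatrix_transport_Tstr (r : k) (M : Matrix (Fin m) (Fin m) k)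
    (g : (Fin (m + 1) → k) ≃ₗ[k] (Fin (m + 1) → k)) :
    ∃ Q Q' : Matrix (Fin m) (Fin m) k, Q * Q' = g.symm (Pi.single 0 1) 0 • 1 ∧
      Q' * Q = g.symm (Pi.single 0 1) 0 • 1 ∧ (g.symm (Pi.single 0 1) 0 = 0 → Q'.rank ≤ 1) ∧
      leftMulMatrix (transport g (Tstr r M)) = Q * M * Q' := by
  let v := g.symm (Pi.single 0 1)
  let inc : (Fin m → k) →ₗ[k] (Fin (m + 1) → k) :=
    { toFun := fun z => Fin.cons 0 z
      map_add' := fun x y => by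
        funext p; refine Fin.cases ?_ (fun p => ?_) p <;> simp
      map_smul' := fun a x => by
        funext p; refine Fin.cases ?_ (fun p => ?_) p <;> simp }
  let pr : (Fin (m + 1) → k) →ₗ[k] (Fin m → k) := LinearMap.funLeft k k Fin.succ
  let Qf : (Fin m → k) →ₗ[k] (Fin m → k) := pr ∘ₗ g.toLinearMap ∘ₗ inc
  let Qf' : (Fin m → k) →ₗ[k] (Fin m → k) :=
    pr ∘ₗ (v 0 • LinearMap.id - (LinearMap.proj 0).smulRight v) ∘ₗ g.symm.toLinearMap ∘ₗ inc
  have hpr : ∀ y : Fin (m + 1) → k, y 0 = 0 → inc (pr y) = y := fun y hy => by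
    funext p
    refine Fin.cases ?_ (fun p => ?_) p
    · simp [inc, hy]
    · simp [inc, pr]
  have hQ' : ∀ z, inc (Qf' z) = v 0 • g.symm (inc z) - g.symm (inc z) 0 • v := fun z => by
    refine (hpr (v 0 • g.symm (inc z) - g.symm (inc z) 0 • v) ?_)
    simp [mul_comm]
  have hgv : g v = Pi.single 0 1 := g.apply_symm_apply _
  have hQQ : ∀ z, Qf (Qf' z) = v 0 • z := fun z => by
    change pr (g (inc (Qf' z))) = _
    rw [hQ', map_sub, map_smul, map_smul, g.apply_symm_apply, hgv]
    funext p
    simp [pr, inc]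
  have hQQ' : ∀ y, Qf' (Qf y) = v 0 • y := fun y => by
    have h1 : inc (Qf y) = g (inc y) - g (inc y) 0 • Pi.single 0 1 := by
      rw [← hpr (g (inc y) - g (inc y) 0 • Pi.single 0 1) (by simp)]
      congr 1
      funext p
      simp [Qf, pr]
    have h2 : g.symm (inc (Qf y)) = inc y - g (inc y) 0 • v := by
      rw [h1, map_sub, map_smul, g.symm_apply_apply]
    have h3 : Qf' (Qf y) = pr (v 0 • g.symm (inc (Qf y)) - g.symm (inc (Qf y)) 0 • v) := rfl
    rw [h3, h2]
    funext p
    simp [pr, inc]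
    ring
  have hinc : ∀ j : Fin m, inc (Pi.single j 1) = Pi.single j.succ 1 := fun j => by
    funext p
    refine Fin.cases ?_ (fun p => ?_) p
    · simp [inc]
    · simp [inc, Pi.single_apply]
  refine ⟨LinearMap.toMatrix' Qf, LinearMap.toMatrix' Qf', ?_, ?_, fun h0 => ?_, ?_⟩
  · rw [← LinearMap.toMatrix'_comp]
    have h1 : Qf ∘ₗ Qf' = v 0 • LinearMap.id := LinearMap.ext hQQ
    rw [h1, map_smul, LinearMap.toMatrix'_id]
  · rw [← LinearMap.toMatrix'_comp]
    have h1 : Qf' ∘ₗ Qf = v 0 • LinearMap.id := LinearMap.ext hQQ'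
    rw [h1, map_smul, LinearMap.toMatrix'_id]
  · have h1 : LinearMap.toMatrix' Qf' =
        vecMulVec (-pr v) fun j => g.symm (inc (Pi.single j 1)) 0 := by
      ext i j
      have h0' : v 0 = 0 := h0
      simp [LinearMap.toMatrix'_apply, Qf', vecMulVec_apply, h0', mul_comm]
    rw [h1]
    exact rank_vecMulVec_le _ _
  · have h2 : LinearMap.toMatrix' Qf * M * LinearMap.toMatrix' Qf' =
        LinearMap.toMatrix' (Qf ∘ₗ Matrix.toLin' M ∘ₗ Qf') := by
      rw [LinearMap.toMatrix'_comp Qf, LinearMap.toMatrix'_comp _ Qf',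
        LinearMap.toMatrix'_toLin', Matrix.mul_assoc]
    rw [h2]
    ext i j
    have h3 : Tstr r M v (g.symm (Pi.single j.succ 1)) =
        (r * g.symm (Pi.single j.succ 1) 0) • v + inc (M *ᵥ Qf' (Pi.single j 1)) := by
      have h4 : Qf' (Pi.single j 1) = v 0 • Fin.tail (g.symm (Pi.single j.succ 1)) -
          g.symm (Pi.single j.succ 1) 0 • Fin.tail v := by
        rw [← hinc]; rfl
      rw [Tstr_apply, h4, mulVec_sub, mulVec_smul, mulVec_smul, map_sub, map_smul, map_smul,
        add_sub_assoc]
      rfl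
    have h5 : structConst (transport g (Tstr r M)) (0, j.succ, i.succ) =
        g (Tstr r M v (g.symm (Pi.single j.succ 1))) i.succ := rfl
    rw [leftMulMatrix, of_apply, h5, h3, map_add, map_smul, hgv]
    simp [LinearMap.toMatrix'_apply, Qf, pr]

theorem leftMulMatrix_Tstr (s : k) (L : Matrix (Fin m) (Fin m) k) :
    leftMulMatrix (Tstr s L) = L := by
  ext i j
  simp [leftMulMatrix, structConst, Tstr_apply, Fin.tail, mulVec, dotProduct, Pi.single_apply]

theorem rank_prodSub_leftMulMatrix_transport_le (r : k) (M : Matrix (Fin m) (Fin m) k)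
    (g : (Fin (m + 1) → k) ≃ₗ[k] (Fin (m + 1) → k)) (w : List k) :
    (prodSub (leftMulMatrix (transport g (Tstr r M)))
      (w.map fun x => g.symm (Pi.single 0 1) 0 * x)).rank ≤ (prodSub M w).rank := by
  obtain ⟨Q, Q', h, h', hrk, hΛ⟩ := exists_leftMulMatrix_transport_Tstr r M g
  rw [hΛ]
  by_cases hc : g.symm (Pi.single 0 1) 0 = 0
  · have h1 := hrk hc
    rw [hc, zero_smul] at h h'
    rw [hc]
    refine rank_prodSub_le_of_sq_eq_zero ?_ ((rank_mul_le_right _ _).trans h1) ?_ w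
    · calc Q * M * Q' * (Q * M * Q') = Q * M * (Q' * Q) * (M * Q') := by
            simp only [Matrix.mul_assoc]
        _ = 0 := by rw [h', Matrix.mul_zero, Matrix.zero_mul]
    · rintro x rfl
      rw [Matrix.mul_smul, Matrix.mul_one, Matrix.smul_mul, h, smul_zero]
  · exact rank_prodSub_le_of_mul_eq_smul_one hc h h' w

theorem eval_eq_zero_of_mem_zclosure {n : ℕ} {S : Set (AlgStr k n)} {χ : AlgStr k n}
    (hχ : χ ∈ zclosure S) (p : MvPolynomial (Fin n × Fin n × Fin n) k)
    (hp : ∀ μ ∈ S, MvPolynomial.eval (structConst μ) p = 0) :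
    MvPolynomial.eval (structConst χ) p = 0 :=
  hχ {μ | MvPolynomial.eval (structConst μ) p = 0} ⟨{p}, fun μ => by simp⟩ hp

theorem exists_rank_prodSub_le_of_integral [IsAlgClosed k] {l : ℕ} {r s : k}
    {M L : Matrix (Fin m) (Fin m) k} (h : degenerates (Tstr r M) (Tstr s L)) (lam : Fin l → k)
    (e : ((Fin (m + 1) → k) ≃ₗ[k] (Fin (m + 1) → k)) → k)
    (he : ∀ g i, e g * lam i = g.symm (Pi.single 0 1) 0 * lam i)
    (her : ∀ g, r * e g = r * g.symm (Pi.single 0 1) 0)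
    (q : Polynomial (MvPolynomial (Fin (m + 1) × Fin (m + 1) × Fin (m + 1)) k)) (hq : q.Monic)
    (heq : ∀ g, q.eval₂ (MvPolynomial.eval (structConst (transport g (Tstr r M)))) (e g) = 0) :
    ∃ c : k, r * c = s ∧ ∀ w : List (Fin l),
      (prodSub L (w.map fun i => c * lam i)).rank ≤ (prodSub M (w.map lam)).rank := by
  obtain ⟨c, hc⟩ := exists_lift_of_integral
    (fun g : (Fin (m + 1) → k) ≃ₗ[k] (Fin (m + 1) → k) => structConst (transport g (Tstr r M)))
    (structConst (Tstr s L))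
    (fun p hp => eval_eq_zero_of_mem_zclosure h p (by rintro _ ⟨g, rfl⟩; exact hp g)) e q hq heq
  refine ⟨c, ?_, fun w => ?_⟩
  · have h1 := hc (MvPolynomial.C r * MvPolynomial.X none - MvPolynomial.X (some (0, 0, 0)))
      fun g => by
        simp [her, structConst_transport_Tstr_zero]
    have h2 : structConst (Tstr s L) (0, 0, 0) = s := by simp [structConst, Tstr_apply]
    simpa [h2, sub_eq_zero] using h1
  · let A : Matrix (Fin m) (Fin m)
        (MvPolynomial (Option (Fin (m + 1) × Fin (m + 1) × Fin (m + 1))) k) :=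
      prodSub (of fun i j => MvPolynomial.X (some (0, j.succ, i.succ)))
        (w.map fun i => MvPolynomial.X none * MvPolynomial.C (lam i))
    have hA : ∀ (μ : AlgStr k (m + 1)) (t : k),
        A.map (MvPolynomial.eval fun o => o.elim t (structConst μ)) =
          prodSub (leftMulMatrix μ) (w.map fun i => t * lam i) := fun μ t => by
      rw [prodSub_map]
      congr 1
      · ext i j
        simp [leftMulMatrix]
      · simp [Function.comp_def]
    have h1 := rank_map_eval_le _ _ hc A (N := (prodSub M (w.map lam)).rank) fun g => by
      have h2 := rank_prodSub_leftMulMatrix_transport_le r M g (w.map lam)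
      rw [List.map_map] at h2
      rw [hA]
      simpa only [he, Function.comp_def] using h2
    rwa [hA, leftMulMatrix_Tstr] at h1

theorem exists_rank_prodSub_le [IsAlgClosed k] {l : ℕ} {r s : k} (hr : r = 0 ∨ r = 1)
    {M L : Matrix (Fin m) (Fin m) k} (h : degenerates (Tstr r M) (Tstr s L)) {lam : Fin l → k}
    (hlam : ∀ i, (M - lam i • (1 : Matrix (Fin m) (Fin m) k)).rank < m) :
    ∃ c : k, r * c = s ∧ ∀ w : List (Fin l),
      (prodSub L (w.map fun i => c * lam i)).rank ≤ (prodSub M (w.map lam)).rank := by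
  rcases hr with rfl | rfl
  · by_cases h0 : ∀ i, lam i = 0
    · exact exists_rank_prodSub_le_of_integral h lam (fun _ => 0) (by simp [h0]) (by simp)
        Polynomial.X Polynomial.monic_X (by simp)
    · push Not at h0
      obtain ⟨i, hi⟩ := h0
      let Λ : Matrix (Fin m) (Fin m)
          (MvPolynomial (Fin (m + 1) × Fin (m + 1) × Fin (m + 1)) k) :=
        of fun i' j => MvPolynomial.C (lam i)⁻¹ * MvPolynomial.X (0, j.succ, i'.succ)
      refine exists_rank_prodSub_le_of_integral h lam (fun g => g.symm (Pi.single 0 1) 0)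
        (fun _ _ => rfl) (fun _ => rfl) Λ.charpoly Λ.charpoly_monic fun g => ?_
      set c := g.symm (Pi.single 0 1) 0 with hc
      have hΛ : Λ.map (MvPolynomial.eval (structConst (transport g (Tstr 0 M)))) =
          (lam i)⁻¹ • leftMulMatrix (transport g (Tstr 0 M)) := by
        ext i' j
        simp [Λ, leftMulMatrix]
      have h1 := rank_prodSub_leftMulMatrix_transport_le 0 M g [lam i]
      simp only [List.map_cons, List.map_nil, prodSub_cons, prodSub_nil, Matrix.mul_one] at h1
      have h2 : (leftMulMatrix (transport g (Tstr 0 M)) -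
          (c * lam i) • (1 : Matrix (Fin m) (Fin m) k)).det = 0 := by
        by_contra hne
        have h3 := rank_of_isUnit _ ((isUnit_iff_isUnit_det _).2 (isUnit_iff_ne_zero.2 hne))
        rw [Fintype.card_fin] at h3
        exact absurd (h3.symm.le.trans h1) (not_le.2 (hlam i))
      rw [← Polynomial.eval_map, ← charpoly_map, hΛ, eval_charpoly]
      have h4 : scalar (Fin m) c - (lam i)⁻¹ • leftMulMatrix (transport g (Tstr 0 M)) =
          (-(lam i)⁻¹) • (leftMulMatrix (transport g (Tstr 0 M)) -
            (c * lam i) • (1 : Matrix (Fin m) (Fin m) k)) := by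
        rw [smul_sub, smul_smul, scalar_apply, ← smul_one_eq_diagonal]
        have h5 : -(lam i)⁻¹ * (c * lam i) = -c := by field_simp
        rw [h5, neg_smul, neg_smul]
        abel
      rw [h4, det_smul, h2, mul_zero]
  · refine exists_rank_prodSub_le_of_integral h lam (fun g => g.symm (Pi.single 0 1) 0)
      (fun _ _ => rfl) (fun _ => rfl) (Polynomial.X - Polynomial.C (MvPolynomial.X (0, 0, 0)))
      (Polynomial.monic_X_sub_C _) fun g => ?_
    simp [structConst_transport_Tstr_zero]

end Necessity

section SpecterOfDegeneration

open Module Matrix Polynomial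

variable {m l : ℕ} {M L : Matrix (Fin m) (Fin m) k} {lam : Fin l → k} {a : Fin l → ℕ → ℕ}

theorem prodSub_replicate (M : Matrix (Fin m) (Fin m) k) (p : ℕ) (c : k) :
    prodSub M (List.replicate p c) = (M - c • (1 : Matrix (Fin m) (Fin m) k)) ^ p := by
  simp [prodSub]

theorem shiftFlag_eq_ker_prodSub (M : Matrix (Fin m) (Fin m) k) (μ : ℕ → k) (p : ℕ) :
    shiftFlag (Matrix.toLinAlgEquiv' M) μ p =
      LinearMap.ker (Matrix.toLinAlgEquiv' (prodSub M ((List.range p).map μ))) := by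
  rw [shiftFlag_eq_ker]
  congr 1
  induction p with
  | zero => simp [prodSub_nil]
  | succ p ih =>
    have h1 : prodSub M ((List.range (p + 1)).map μ) =
        prodSub M ((List.range p).map μ) * (M - μ p • (1 : Matrix (Fin m) (Fin m) k)) := by
      simp [prodSub, List.range_succ]
    rw [Finset.prod_range_succ, map_mul, ih, h1, map_mul]
    simp [Algebra.algebraMap_eq_smul_one]

theorem IsFullSpecter.rank_lt (hm : 1 ≤ m) (h : IsFullSpecter M lam a) (i : Fin l) :
    (M - lam i • (1 : Matrix (Fin m) (Fin m) k)).rank < m := by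
  have h1 := rank_sub_smul_pow_add_finrank_ker M (lam i) 1
  rw [(h.2.1 i).1.finrank_ker, pow_one] at h1
  have h2 : min (a i 0) 1 ≤ ∑ t ∈ Finset.range m, min (a i t) 1 :=
    Finset.single_le_sum (f := fun t => min (a i t) 1) (fun _ _ => Nat.zero_le _)
      (Finset.mem_range.2 hm)
  have h3 := (h.2.1 i).2
  omega

theorem IsSpectralData.exists_isFullSpecter_of_rank_le {κ : Fin l → ℕ} {c : k} (hc : c ≠ 0)
    (h : IsSpectralData (Matrix.toLinAlgEquiv' M) lam a) (ha : ∀ i, a i 0 ≠ 0) (hm : 1 ≤ m)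
    (hκ : ∀ i, IsPartitionOf (a i) (κ i))
    (hrk : ∀ w : List (Fin l),
      (prodSub L (w.map fun i => c * lam i)).rank ≤ (prodSub M (w.map lam)).rank) :
    ∃ b : Fin l → ℕ → ℕ, IsFullSpecter L (fun i => c * lam i) b ∧
      ∀ i, IsPartitionOf (b i) (κ i) ∧ Dominates (a i) (b i) := by
  obtain ⟨b, hb, hsum, hdom⟩ := h.exists_dominated (g := Matrix.toLinAlgEquiv' L) hc fun i p => by
    have h1 := hrk (List.replicate p i)
    rw [List.map_replicate, List.map_replicate, prodSub_replicate, prodSub_replicate] at h1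
    have h2 := rank_sub_smul_pow_add_finrank_ker M (lam i) p
    have h3 := rank_sub_smul_pow_add_finrank_ker L (c * lam i) p
    omega
  have hsum' : ∀ i, ∑ t ∈ Finset.range (finrank k (Fin m → k)), b i t = κ i := fun i =>
    (hsum i).trans (h.sum_range (hκ i))
  refine ⟨b, hb.isFullSpecter fun i h0 => ?_, fun i =>
    ⟨⟨fun _ _ hij => hb.anti i hij, _, hb.zero i, hsum' i⟩, hdom i⟩⟩
  have h1 := hsum i
  rw [Finset.sum_eq_zero fun t _ => Nat.le_zero.1 ((hb.anti i (Nat.zero_le t)).trans_eq h0)] at h1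
  refine ha i (Finset.sum_eq_zero_iff.1 h1.symm 0 ?_)
  rw [finrank_fin_fun]
  exact Finset.mem_range.2 hm

theorem IsSpectralData.exists_isJordanTypeAt_zero_of_rank_le
    (h : IsSpectralData (Matrix.toLinAlgEquiv' M) lam a) (hm : 1 ≤ m)
    (hrk : ∀ w : List (Fin l),
      (prodSub L (w.map fun i => 0 * lam i)).rank ≤ (prodSub M (w.map lam)).rank) :
    ∃ b : ℕ → ℕ, IsJordanTypeAt L 0 b ∧ IsPartitionOf b m ∧
      Dominates (fun t => ∑ i, a i t) b := by
  obtain ⟨b, hb, hb0, hker, hsum, hdom⟩ := h.exists_dominated_zero (g := Matrix.toLinAlgEquiv' L)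
    (by rw [finrank_fin_fun]; exact hm) fun w p => by
      have h1 := hrk ((List.range p).map w)
      have h2 := rank_add_finrank_ker (prodSub M ((List.range p).map fun j => lam (w j)))
      have h3 := rank_sub_smul_pow_add_finrank_ker L 0 p
      have h4 : (((List.range p).map w).map fun i => 0 * lam i) = List.replicate p (0 : k) :=
        List.eq_replicate_iff.2 ⟨by simp, by simp⟩
      rw [h4, prodSub_replicate, List.map_map] at h1
      rw [zero_smul, zero_smul, sub_zero, sub_zero] at h3
      rw [zero_smul, sub_zero] at h1
      rw [shiftFlag_eq_ker_prodSub]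
      simp only [Function.comp_def] at h1
      omega
  rw [finrank_fin_fun] at hb0 hsum
  refine ⟨b, IsJordanTypeAt.of_finrank_ker hb hb0 fun p => ?_, ⟨fun _ _ hij => hb hij, m, hb0, hsum⟩,
    hdom⟩
  rw [zero_smul, sub_zero, hker, finrank_fin_fun]

end SpecterOfDegeneration

/-! ## STATEMENT 6 -/
theorem stmt6 {k : Type*} [Field k] [IsAlgClosed k] (m l : ℕ) (hm : 1 ≤ m)
    (r s : k) (hr : r = 0 ∨ r = 1) (hs : s = 0 ∨ s = 1)
    (M L : Matrix (Fin m) (Fin m) k)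
    (lam : Fin l → k) (a : Fin l → ℕ → ℕ) (κ : Fin l → ℕ)
    (hFS : IsFullSpecter M lam a) (hκ : ∀ i, IsPartitionOf (a i) (κ i)) :
    degenerates (Tstr r M) (Tstr s L) ↔
      ((r = 1 ∧ s = 1 ∧ ∃ b : Fin l → ℕ → ℕ, IsFullSpecter L lam b ∧
          ∀ i, IsPartitionOf (b i) (κ i) ∧ Dominates (a i) (b i)) ∨
       (r = 0 ∧ s = 0 ∧ ∃ α : k, α ≠ 0 ∧ ∃ b : Fin l → ℕ → ℕ,
          IsFullSpecter L (fun i => α * lam i) b ∧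
          ∀ i, IsPartitionOf (b i) (κ i) ∧ Dominates (a i) (b i)) ∨
       (s = 0 ∧ ∃ b : ℕ → ℕ, IsJordanTypeAt L 0 b ∧ IsPartitionOf b m ∧
          Dominates (fun t => ∑ i, a i t) b)) := by
  have hM := hFS.isSpectralData
  have : Infinite k := IsAlgClosed.instInfinite
  constructor
  · intro h
    obtain ⟨c, hc, hrk⟩ := exists_rank_prodSub_le hr h (hFS.rank_lt hm)
    by_cases hc0 : c = 0
    · subst hc0
      exact Or.inr (Or.inr ⟨by rw [← hc, mul_zero], hM.exists_isJordanTypeAt_zero_of_rank_le hm hrk⟩)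
    obtain ⟨b, hb⟩ := hM.exists_isFullSpecter_of_rank_le hc0 (fun i => (hFS.2.1 i).2) hm hκ hrk
    rcases hr with rfl | rfl
    · exact Or.inr (Or.inl ⟨rfl, by rw [← hc, zero_mul], c, hc0, b, hb⟩)
    · rw [one_mul] at hc
      subst hc
      have hc1 : c = 1 := hs.resolve_left hc0
      subst hc1
      simp only [one_mul] at hb
      exact Or.inl ⟨rfl, rfl, b, hb⟩
  · rintro (⟨rfl, rfl, b, hL, hb⟩ | ⟨rfl, rfl, α, hα, b, hL, hb⟩ | ⟨rfl, b, hL, hb, hdom⟩)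
    · have hL' := hL.isSpectralData
      have h1 := degenerates_Tstr_smul (b := b) hm 1 one_ne_zero hM
        (by simpa only [one_mul] using hL') hκ (fun i => (hb i).1) fun i => (hb i).2
      rwa [one_mul] at h1
    · have h1 := degenerates_Tstr_smul hm 0 hα hM hL.isSpectralData hκ (fun i => (hb i).1)
        fun i => (hb i).2
      rwa [mul_zero] at h1
    · exact degenerates_Tstr_zero hm r hM hL hb hdom

end
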